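/- arXiv:2001.01435 — 13 statements merged into one kernel-verified Lean document; each statement's English description precedes it below -/
import Mathlib

section
/- Let 0 < ℓ < u be real numbers and let f : ℝ → ℝ be nonnegative, continuous, and convex on [ℓ,u]. Then the 3-dimensional Lebesgue volume of the convex hull of the set {(0,0,0)} ∪ {(x,y,1) ∈ ℝ³ : ℓ ≤ x ≤ u, f(x) ≤ y ≤ f(ℓ) + ((f(u)−f(ℓ))/(u−ℓ))·(x−ℓ)} equals (1/6)·(u−ℓ)·(f(u)+f(ℓ)) − (1/3)·∫_ℓ^u f(x) dx. -/
open MeasureTheory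
open scoped Pointwise

/-- The volume of the cone with apex the origin over a convex compact planar base
placed at height one is a third of the area of the base. -/
theorem volume_convexHull_cone {D : Set (ℝ × ℝ)} (hD : Convex ℝ D) (hc : IsCompact D)
    (hne : D.Nonempty) :
    volume (convexHull ℝ
      ({((0 : ℝ), (0 : ℝ), (0 : ℝ))} ∪ {q : ℝ × ℝ × ℝ | q.2.2 = 1 ∧ (q.1, q.2.1) ∈ D}))
      = ENNReal.ofReal (1 / 3) * volume D := by
  set S : Set (ℝ × ℝ × ℝ) := {q | q.2.2 = 1 ∧ (q.1, q.2.1) ∈ D} with hS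
  have hSconv : Convex ℝ S := by
    rintro ⟨x, y, t⟩ ⟨ht, hp⟩ ⟨x', y', t'⟩ ⟨ht', hp'⟩ a b ha hb hab
    refine ⟨?_, hD hp hp' ha hb hab⟩
    simp only [Prod.snd_add, Prod.smul_snd, smul_eq_mul] at *
    rw [ht, ht', mul_one, mul_one, hab]
  have hSne : S.Nonempty := by
    obtain ⟨⟨x, y⟩, hp⟩ := hne
    exact ⟨(x, y, 1), rfl, hp⟩
  have hull : convexHull ℝ ({((0 : ℝ), (0 : ℝ), (0 : ℝ))} ∪ S)
      = (fun r : ℝ × ℝ × ℝ => (r.1 * r.2.1, r.1 * r.2.2, r.1)) '' (Set.Icc 0 1 ×ˢ D) := by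
    rw [Set.singleton_union, convexHull_insert hSne, hSconv.convexHull_eq]
    ext ⟨x, y, t⟩
    simp only [mem_convexJoin, Set.mem_singleton_iff, exists_eq_left, Set.mem_image, Set.mem_prod]
    constructor
    · rintro ⟨⟨x', y', t'⟩, ⟨ht', hp⟩, a, b, ha, hb, hab, h⟩
      simp only [Prod.smul_mk, smul_eq_mul, Prod.mk_add_mk, Prod.mk.injEq] at h ht' hp
      subst ht'
      refine ⟨(b, x', y'), ⟨⟨hb, by linarith⟩, hp⟩, ?_⟩
      simp only [Prod.mk.injEq]
      exact ⟨by linarith [h.1], by linarith [h.2.1], by linarith [h.2.2]⟩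
    · rintro ⟨⟨b, x', y'⟩, ⟨⟨hb, hb'⟩, hp⟩, h⟩
      simp only [Prod.mk.injEq] at h hb hb' hp
      refine ⟨(x', y', 1), ⟨rfl, hp⟩, 1 - b, b, by linarith, hb, by ring, ?_⟩
      simp only [Prod.smul_mk, smul_eq_mul, Prod.mk_add_mk, Prod.mk.injEq]
      exact ⟨by linarith [h.1], by linarith [h.2.1], by linarith [h.2.2]⟩
  have hmeas : MeasurableSet (convexHull ℝ ({((0 : ℝ), (0 : ℝ), (0 : ℝ))} ∪ S)) := by
    rw [hull]
    exact ((isCompact_Icc.prod hc).image (by fun_prop)).measurableSet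
  rw [← (volume_preserving_prodAssoc (α₁ := ℝ) (β₁ := ℝ) (γ₁ := ℝ)).measure_preimage
    hmeas.nullMeasurableSet, Measure.volume_eq_prod (ℝ × ℝ) ℝ,
    Measure.prod_apply_symm (MeasurableEquiv.prodAssoc.measurable hmeas), hull]
  have slice : ∀ t : ℝ, t ≠ 0 → volume ((fun p : ℝ × ℝ => (p, t)) ⁻¹'
      ((MeasurableEquiv.prodAssoc : (ℝ × ℝ) × ℝ ≃ᵐ ℝ × ℝ × ℝ) ⁻¹'
        ((fun r : ℝ × ℝ × ℝ => (r.1 * r.2.1, r.1 * r.2.2, r.1)) '' (Set.Icc 0 1 ×ˢ D))))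
      = (Set.Ioc (0 : ℝ) 1).indicator (fun t => ENNReal.ofReal (t ^ 2) * volume D) t := by
    intro t ht0
    by_cases ht : t ∈ Set.Ioc (0 : ℝ) 1
    · rw [Set.indicator_of_mem ht]
      have : ((fun p : ℝ × ℝ => (p, t)) ⁻¹'
        ((MeasurableEquiv.prodAssoc : (ℝ × ℝ) × ℝ ≃ᵐ ℝ × ℝ × ℝ) ⁻¹'
        ((fun r : ℝ × ℝ × ℝ => (r.1 * r.2.1, r.1 * r.2.2, r.1)) '' (Set.Icc 0 1 ×ˢ D))))
          = t • D := by
        ext ⟨x, y⟩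
        simp only [Set.mem_preimage, MeasurableEquiv.prodAssoc, MeasurableEquiv.coe_mk,
          Equiv.prodAssoc_apply, Set.mem_image, Set.mem_prod, Set.mem_smul_set, Prod.exists,
          Prod.mk.injEq, Prod.smul_mk, smul_eq_mul]
        constructor
        · rintro ⟨b, x', y', ⟨-, hp⟩, h1, h2, rfl⟩
          exact ⟨x', y', hp, h1, h2⟩
        · rintro ⟨x', y', hp, h1, h2⟩
          exact ⟨t, x', y', ⟨⟨ht.1.le, ht.2⟩, hp⟩, h1, h2, rfl⟩
      rw [this, Measure.addHaar_smul]
      simp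
    · rw [Set.indicator_of_notMem ht]
      convert measure_empty (μ := (volume : Measure (ℝ × ℝ)))
      rw [Set.eq_empty_iff_forall_notMem]
      rintro ⟨x, y⟩ ⟨⟨b, x', y'⟩, ⟨⟨hb, hb'⟩, -⟩, h⟩
      have hbt : b = t := congrArg (fun q : ℝ × ℝ × ℝ => q.2.2) h
      subst hbt
      exact ht ⟨lt_of_le_of_ne hb (Ne.symm ht0), hb'⟩
  have hae : ∀ᵐ t : ℝ, t ≠ 0 := by simp [ae_iff]
  rw [lintegral_congr_ae (hae.mono slice), lintegral_indicator measurableSet_Ioc,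
    lintegral_mul_const _ (by fun_prop), ← ofReal_integral_eq_lintegral_ofReal,
    ← intervalIntegral.integral_of_le zero_le_one, integral_pow]
  · norm_num
  · exact (Continuous.integrableOn_Icc (by fun_prop)).mono_set Set.Ioc_subset_Icc_self
  · exact .of_forall fun t => sq_nonneg t

theorem volume_between_Icc {a b : ℝ} (hab : a ≤ b) {f g : ℝ → ℝ}
    (hf : ContinuousOn f (Set.Icc a b)) (hg : ContinuousOn g (Set.Icc a b))
    (hfg : ∀ x ∈ Set.Icc a b, f x ≤ g x)
    (hm : MeasurableSet {p : ℝ × ℝ | p.1 ∈ Set.Icc a b ∧ p.2 ∈ Set.Icc (f p.1) (g p.1)}) :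
    volume {p : ℝ × ℝ | p.1 ∈ Set.Icc a b ∧ p.2 ∈ Set.Icc (f p.1) (g p.1)}
      = ENNReal.ofReal (∫ x in a..b, (g x - f x)) := by
  rw [Measure.volume_eq_prod, Measure.prod_apply hm]
  have slice : ∀ x : ℝ, volume (Prod.mk x ⁻¹'
      {p : ℝ × ℝ | p.1 ∈ Set.Icc a b ∧ p.2 ∈ Set.Icc (f p.1) (g p.1)})
      = (Set.Icc a b).indicator (fun x => ENNReal.ofReal (g x - f x)) x := by
    intro x
    by_cases hx : x ∈ Set.Icc a b
    · rw [Set.indicator_of_mem hx, ← Real.volume_Icc]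
      congr 1
      ext y
      exact ⟨fun h => h.2, fun h => ⟨hx, h⟩⟩
    · rw [Set.indicator_of_notMem hx]
      convert measure_empty (μ := (volume : Measure ℝ))
      exact Set.eq_empty_iff_forall_notMem.2 fun y h => hx h.1
  rw [lintegral_congr slice, lintegral_indicator measurableSet_Icc,
    ← ofReal_integral_eq_lintegral_ofReal, intervalIntegral.integral_of_le hab,
    integral_Icc_eq_integral_Ioc]
  · exact (hg.sub hf).integrableOn_Icc
  · exact (ae_restrict_mem measurableSet_Icc).mono fun x hx => sub_nonneg.2 (hfg x hx)

theorem isCompact_between_Icc {a b : ℝ} {f g : ℝ → ℝ}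
    (hf : ContinuousOn f (Set.Icc a b)) (hg : ContinuousOn g (Set.Icc a b))
    (hfg : ∀ x ∈ Set.Icc a b, f x ≤ g x) :
    IsCompact {p : ℝ × ℝ | p.1 ∈ Set.Icc a b ∧ p.2 ∈ Set.Icc (f p.1) (g p.1)} := by
  have himage : {p : ℝ × ℝ | p.1 ∈ Set.Icc a b ∧ p.2 ∈ Set.Icc (f p.1) (g p.1)}
      = (fun r : ℝ × ℝ => (r.1, (1 - r.2) * f r.1 + r.2 * g r.1)) ''
        (Set.Icc a b ×ˢ Set.Icc 0 1) := by
    ext ⟨x, y⟩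
    constructor
    · rintro ⟨hx, hy⟩
      rw [← segment_eq_Icc (hfg x hx)] at hy
      obtain ⟨s, t, hs, ht, hst, h⟩ := hy
      refine ⟨(x, t), ⟨hx, ht, by linarith⟩, ?_⟩
      obtain rfl : s = 1 - t := by linarith
      exact Prod.ext rfl h
    · rintro ⟨⟨x', t⟩, ⟨hx, ht⟩, h⟩
      simp only [Prod.mk.injEq] at h hx ht
      obtain ⟨rfl, rfl⟩ := h
      have := hfg x' hx
      refine ⟨hx, ?_, ?_⟩ <;> simp only <;> nlinarith [ht.1, ht.2]
  rw [himage]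
  refine (isCompact_Icc.prod isCompact_Icc).image_of_continuousOn ?_
  have hf' := hf.comp (continuousOn_fst (s := Set.Icc a b ×ˢ Set.Icc (0 : ℝ) 1))
    fun r hr => hr.1
  have hg' := hg.comp (continuousOn_fst (s := Set.Icc a b ×ˢ Set.Icc (0 : ℝ) 1))
    fun r hr => hr.1
  exact continuousOn_fst.prodMk (((continuousOn_const.sub continuousOn_snd).mul hf').add
    (continuousOn_snd.mul hg'))

theorem ConvexOn.convex_between {s : Set ℝ} {f g : ℝ → ℝ} (hf : ConvexOn ℝ s f)
    (hg : ConcaveOn ℝ s g) :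
    Convex ℝ {p : ℝ × ℝ | p.1 ∈ s ∧ p.2 ∈ Set.Icc (f p.1) (g p.1)} := by
  convert hf.convex_epigraph.inter hg.convex_hypograph using 1
  ext p
  simp only [Set.mem_ofPred_eq, Set.mem_Icc, Set.mem_inter_iff]
  tauto

theorem ConvexOn.le_secant {a b : ℝ} (hab : a < b) {f : ℝ → ℝ} (hf : ConvexOn ℝ (Set.Icc a b) f)
    {x : ℝ} (hx : x ∈ Set.Icc a b) : f x ≤ f a + (f b - f a) / (b - a) * (x - a) := by
  have hba : 0 < b - a := sub_pos.2 hab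
  have h := hf.2 (Set.left_mem_Icc.2 hab.le) (Set.right_mem_Icc.2 hab.le)
    (div_nonneg (sub_nonneg.2 hx.2) hba.le) (div_nonneg (sub_nonneg.2 hx.1) hba.le)
    (by field_simp; ring)
  have hne : b - a ≠ 0 := hba.ne'
  have hleft : (b - x) / (b - a) * a + (x - a) / (b - a) * b = x := by
    field_simp
    ring
  have hright : (b - x) / (b - a) * f a + (x - a) / (b - a) * f b
      = f a + (f b - f a) / (b - a) * (x - a) := by
    field_simp
    ring
  simp only [smul_eq_mul] at h
  rwa [hleft, hright] at h

theorem perspective_volume (ℓ u : ℝ) (f : ℝ → ℝ)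
    (hℓ : 0 < ℓ) (hℓu : ℓ < u)
    (hf_nonneg : ∀ x ∈ Set.Icc ℓ u, 0 ≤ f x)
    (hf_cont : ContinuousOn f (Set.Icc ℓ u))
    (hf_conv : ConvexOn ℝ (Set.Icc ℓ u) f) :
    volume (convexHull ℝ
      ({((0:ℝ), (0:ℝ), (0:ℝ))} ∪
        {q : ℝ × ℝ × ℝ | q.2.2 = 1 ∧ ℓ ≤ q.1 ∧ q.1 ≤ u ∧
          f q.1 ≤ q.2.1 ∧
          q.2.1 ≤ f ℓ + (f u - f ℓ) / (u - ℓ) * (q.1 - ℓ)}))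
    = ENNReal.ofReal
        ((1/6) * (u - ℓ) * (f u + f ℓ) - (1/3) * ∫ x in ℓ..u, f x) := by
  set g : ℝ → ℝ := fun x => f ℓ + (f u - f ℓ) / (u - ℓ) * (x - ℓ) with hg
  have hfg : ∀ x ∈ Set.Icc ℓ u, f x ≤ g x := fun x hx => hf_conv.le_secant hℓu hx
  have hgc : Continuous g := by fun_prop
  have hgconc : ConcaveOn ℝ (Set.Icc ℓ u) g := by
    refine ⟨convex_Icc ℓ u, fun x _ y _ a b _ _ hab => le_of_eq ?_⟩
    obtain rfl : b = 1 - a := by linarith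
    simp only [hg, smul_eq_mul]
    ring
  have hcompact := isCompact_between_Icc hf_cont hgc.continuousOn hfg
  have hℓmem : ℓ ∈ Set.Icc ℓ u := Set.left_mem_Icc.2 hℓu.le
  have hcone := volume_convexHull_cone (hf_conv.convex_between hgconc) hcompact
    ⟨(ℓ, f ℓ), hℓmem, le_rfl, hfg ℓ hℓmem⟩
  rw [volume_between_Icc hℓu.le hf_cont hgc.continuousOn hfg hcompact.measurableSet,
    ← ENNReal.ofReal_mul (by norm_num)] at hcone
  have hint : IntervalIntegrable f volume ℓ u := hf_cont.intervalIntegrable_of_Icc hℓu.le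
  have hgint : ∫ x in ℓ..u, g x = (u - ℓ) * (f u + f ℓ) / 2 := by
    have hne : u - ℓ ≠ 0 := (sub_pos.2 hℓu).ne'
    simp only [hg]
    rw [intervalIntegral.integral_add (by simp) (Continuous.intervalIntegrable (by fun_prop) _ _),
      intervalIntegral.integral_const_mul, intervalIntegral.integral_sub (by simp) (by simp)]
    simp only [intervalIntegral.integral_const, integral_id, smul_eq_mul]
    field_simp
    ring
  rw [intervalIntegral.integral_sub (hgc.intervalIntegrable _ _) hint, hgint] at hcone
  convert hcone using 2
  · congr 2
    ext q
    simp only [Set.mem_ofPred_eq, Set.mem_Icc, and_assoc, hg]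
  · ring
end

section
/- Let b > 1 and a ∈ ℝ with b^ℓ + a ≥ 0, let 0 < ℓ < u, and let f(x) := b^x + a. Then the 3-dimensional Lebesgue volume of the convex hull of {(0,0,0)} ∪ {(x,y,1) ∈ ℝ³ : ℓ ≤ x ≤ u, f(x) ≤ y ≤ f(ℓ) + ((f(u)−f(ℓ))/(u−ℓ))·(x−ℓ)} equals (1/6)·(u−ℓ)·(b^u + b^ℓ) − (1/(3·log b))·(b^u − b^ℓ); in particular it is independent of a. -/
open MeasureTheory

/-- The convex hull of the origin and a copy of a convex set `K` at height `1`. -/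
theorem convexHull_origin_union_height_one {K : Set (ℝ × ℝ)} (hK : Convex ℝ K)
    (hne : K.Nonempty) :
    convexHull ℝ ({((0:ℝ), (0:ℝ), (0:ℝ))} ∪ {q : ℝ × ℝ × ℝ | q.2.2 = 1 ∧ (q.1, q.2.1) ∈ K}) =
      {((0:ℝ), (0:ℝ), (0:ℝ))} ∪
        {q : ℝ × ℝ × ℝ | 0 < q.2.2 ∧ q.2.2 ≤ 1 ∧ q.2.2⁻¹ • (q.1, q.2.1) ∈ K} := by
  have hS : Convex ℝ {q : ℝ × ℝ × ℝ | q.2.2 = 1 ∧ (q.1, q.2.1) ∈ K} := by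
    rintro ⟨x, y, z⟩ ⟨hz, hp⟩ ⟨x', y', z'⟩ ⟨hz', hp'⟩ s t hs ht hst
    refine ⟨?_, hK hp hp' hs ht hst⟩
    simp only at hz hz'
    simp [hz, hz', hst]
  obtain ⟨⟨x₀, y₀⟩, h₀⟩ := hne
  have hSne : {q : ℝ × ℝ × ℝ | q.2.2 = 1 ∧ (q.1, q.2.1) ∈ K}.Nonempty := ⟨(x₀, y₀, 1), rfl, h₀⟩
  rw [Set.singleton_union, convexHull_insert hSne, hS.convexHull_eq]
  ext ⟨x, y, z⟩
  simp only [convexJoin_singleton_left, Set.mem_iUnion, Set.singleton_union,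
    Set.mem_insert_iff, Set.mem_ofPred_eq, exists_prop]
  constructor
  · rintro ⟨⟨x', y', z'⟩, ⟨hz', hp⟩, s, t, hs, ht, hst, h⟩
    simp only at hz' hp
    subst hz'
    simp only [Prod.smul_mk, Prod.mk_add_mk, smul_eq_mul, Prod.mk.injEq, mul_zero, zero_add,
      mul_one] at h
    obtain ⟨rfl, rfl, rfl⟩ := h
    rcases ht.eq_or_lt with rfl | ht
    · simp
    · refine Or.inr ⟨ht, by linarith, ?_⟩
      simpa [ht.ne'] using hp
  · rintro (h | ⟨hz, hz1, hp⟩)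
    · exact ⟨(x₀, y₀, 1), ⟨rfl, h₀⟩, h ▸ left_mem_segment ℝ _ _⟩
    · refine ⟨(z⁻¹ * x, z⁻¹ * y, 1), ⟨rfl, hp⟩, 1 - z, z, by linarith, hz.le, by ring, ?_⟩
      simp [hz.ne']

open scoped Pointwise in
/-- The volume of a cone of height `1` with apex the origin is a third of the area of its base. -/
theorem volume_convexHull_origin_union_height_one {K : Set (ℝ × ℝ)} (hK : Convex ℝ K)
    (hm : MeasurableSet K) (hne : K.Nonempty) :
    volume (convexHull ℝ
      ({((0:ℝ), (0:ℝ), (0:ℝ))} ∪ {q : ℝ × ℝ × ℝ | q.2.2 = 1 ∧ (q.1, q.2.1) ∈ K})) =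
      ENNReal.ofReal (1 / 3) * volume K := by
  have hmeas : MeasurableSet
      {q : (ℝ × ℝ) × ℝ | 0 < q.2 ∧ q.2 ≤ 1 ∧ q.2⁻¹ • q.1 ∈ K} :=
    (measurableSet_lt measurable_const measurable_snd).inter
      ((measurableSet_le measurable_snd measurable_const).inter
        ((measurable_snd.inv.smul measurable_fst) hm))
  have hslice (z : ℝ) : volume ((fun p : ℝ × ℝ => (p, z)) ⁻¹'
      {q : (ℝ × ℝ) × ℝ | 0 < q.2 ∧ q.2 ≤ 1 ∧ q.2⁻¹ • q.1 ∈ K}) =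
      (Set.Ioc (0:ℝ) 1).indicator (fun z => ENNReal.ofReal (z ^ 2) * volume K) z := by
    by_cases hz : z ∈ Set.Ioc (0:ℝ) 1
    · have : (fun p : ℝ × ℝ => (p, z)) ⁻¹'
          {q : (ℝ × ℝ) × ℝ | 0 < q.2 ∧ q.2 ≤ 1 ∧ q.2⁻¹ • q.1 ∈ K} = z • K := by
        ext p
        rw [Set.mem_smul_set_iff_inv_smul_mem₀ hz.1.ne']
        simp [hz.1, hz.2]
      rw [this, Set.indicator_of_mem hz, Measure.addHaar_smul]
      simp
    · rw [Set.indicator_of_notMem hz]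
      convert measure_empty (μ := (volume : Measure (ℝ × ℝ)))
      ext p
      simp only [Set.mem_preimage, Set.mem_ofPred_eq, Set.mem_empty_iff_false, iff_false]
      exact fun h => hz ⟨h.1, h.2.1⟩
  have hzero : volume {((0:ℝ), (0:ℝ), (0:ℝ))} = 0 := by
    rw [Measure.volume_eq_prod]
    exact measure_singleton _
  rw [convexHull_origin_union_height_one hK hne,
    measure_congr (union_ae_eq_right_of_ae_eq_empty (ae_eq_empty.2 hzero)),
    ← MeasurePreserving.measure_preimage_equiv (f := MeasurableEquiv.prodAssoc)
      (volume_preserving_prodAssoc (α₁ := ℝ) (β₁ := ℝ) (γ₁ := ℝ))]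
  change volume {q : (ℝ × ℝ) × ℝ | 0 < q.2 ∧ q.2 ≤ 1 ∧ q.2⁻¹ • q.1 ∈ K} = _
  rw [Measure.volume_eq_prod, Measure.prod_apply_symm hmeas]
  simp_rw [hslice]
  rw [lintegral_indicator measurableSet_Ioc, lintegral_mul_const _ (by fun_prop),
    ← ofReal_integral_eq_lintegral_ofReal _ (ae_of_all _ fun z => sq_nonneg z),
    ← intervalIntegral.integral_of_le zero_le_one]
  · norm_num
  · exact (Continuous.integrableOn_Icc (by fun_prop)).mono_set Set.Ioc_subset_Icc_self

/-- The area between two continuous functions over a compact interval, boundary included. -/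
theorem volume_region_between_Icc {f g : ℝ → ℝ} {a b : ℝ} (hab : a ≤ b) (hf : Continuous f)
    (hg : Continuous g) (hfg : ∀ x ∈ Set.Icc a b, f x ≤ g x) :
    volume {p : ℝ × ℝ | a ≤ p.1 ∧ p.1 ≤ b ∧ f p.1 ≤ p.2 ∧ p.2 ≤ g p.1} =
      ENNReal.ofReal (∫ x in a..b, (g x - f x)) := by
  have hm : MeasurableSet {p : ℝ × ℝ | a ≤ p.1 ∧ p.1 ≤ b ∧ f p.1 ≤ p.2 ∧ p.2 ≤ g p.1} := by
    measurability
  have hslice (x : ℝ) : volume (Prod.mk x ⁻¹'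
      {p : ℝ × ℝ | a ≤ p.1 ∧ p.1 ≤ b ∧ f p.1 ≤ p.2 ∧ p.2 ≤ g p.1}) =
      (Set.Icc a b).indicator (fun x => ENNReal.ofReal (g x - f x)) x := by
    by_cases hx : x ∈ Set.Icc a b
    · rw [Set.indicator_of_mem hx, ← Real.volume_Icc]
      congr 1
      ext y
      simp [hx.1, hx.2]
    · rw [Set.indicator_of_notMem hx]
      convert measure_empty (μ := (volume : Measure ℝ))
      ext y
      simp only [Set.mem_preimage, Set.mem_ofPred_eq, Set.mem_empty_iff_false, iff_false]
      exact fun h => hx ⟨h.1, h.2.1⟩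
  rw [Measure.volume_eq_prod, Measure.prod_apply hm]
  simp_rw [hslice]
  rw [lintegral_indicator measurableSet_Icc, intervalIntegral.integral_of_le hab,
    ← integral_Icc_eq_integral_Ioc, ofReal_integral_eq_lintegral_ofReal]
  · exact (hg.sub hf).integrableOn_Icc
  · exact (ae_restrict_iff' measurableSet_Icc).2
      (ae_of_all _ fun x hx => sub_nonneg.2 (hfg x hx))

/-- A convex function lies below its chords. -/
theorem ConvexOn.le_chord {f : ℝ → ℝ} (hf : ConvexOn ℝ Set.univ f) {a b x : ℝ} (hab : a < b)
    (hx : x ∈ Set.Icc a b) : f x ≤ f a + (f b - f a) / (b - a) * (x - a) := by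
  have hd : 0 < b - a := sub_pos.2 hab
  have h := hf.2 (Set.mem_univ a) (Set.mem_univ b)
    (div_nonneg (sub_nonneg.2 hx.2) hd.le) (div_nonneg (sub_nonneg.2 hx.1) hd.le)
    (by field_simp; simp)
  simp only [smul_eq_mul] at h
  have hx' : (b - x) / (b - a) * a + (x - a) / (b - a) * b = x := by
    field_simp
    ring
  rw [hx'] at h
  refine h.trans_eq ?_
  field_simp
  ring

theorem integral_const_rpow {b : ℝ} (hb : 1 < b) (ℓ u : ℝ) :
    ∫ x in ℓ..u, b ^ x = (b ^ u - b ^ ℓ) / Real.log b := by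
  have hb0 : 0 < b := by linarith
  have hlog : Real.log b ≠ 0 := (Real.log_pos hb).ne'
  have hc : Continuous fun x : ℝ => b ^ x := Real.continuous_const_rpow hb0.ne'
  rw [intervalIntegral.integral_eq_sub_of_hasDerivAt (f := fun x => b ^ x / Real.log b)
    (fun x _ => ?_) (hc.intervalIntegrable _ _)]
  · ring
  · simpa [hlog] using (Real.hasStrictDerivAt_const_rpow hb0 x).hasDerivAt.div_const (Real.log b)

theorem perspective_volume_exponential (a b ℓ u : ℝ) (hb : 1 < b)
    (ha : 0 ≤ b ^ ℓ + a) (hℓ : 0 < ℓ) (hℓu : ℓ < u) (f : ℝ → ℝ)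
    (hf : ∀ x : ℝ, f x = b ^ x + a) :
    volume (convexHull ℝ
      ({((0:ℝ), (0:ℝ), (0:ℝ))} ∪
        {q : ℝ × ℝ × ℝ | q.2.2 = 1 ∧ ℓ ≤ q.1 ∧ q.1 ≤ u ∧
          f q.1 ≤ q.2.1 ∧
          q.2.1 ≤ f ℓ + (f u - f ℓ) / (u - ℓ) * (q.1 - ℓ)}))
    = ENNReal.ofReal
        ((1/6) * (u - ℓ) * (b ^ u + b ^ ℓ)
          - (1 / (3 * Real.log b)) * (b ^ u - b ^ ℓ)) := by
  have hb0 : 0 < b := by linarith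
  have hlog : Real.log b ≠ 0 := (Real.log_pos hb).ne'
  have hpow : Continuous fun x : ℝ => b ^ x := Real.continuous_const_rpow hb0.ne'
  have hfc : Continuous f := by
    rw [funext hf]
    fun_prop
  have hconv : ConvexOn ℝ Set.univ f := by
    rw [funext hf]
    exact (convexOn_rpow_left hb0).add_const a
  set c := (f u - f ℓ) / (u - ℓ) with hc
  let K : Set (ℝ × ℝ) :=
    {p | ℓ ≤ p.1 ∧ p.1 ≤ u ∧ f p.1 ≤ p.2 ∧ p.2 ≤ f ℓ + c * (p.1 - ℓ)}
  have hK : Convex ℝ K := by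
    rintro ⟨x, y⟩ ⟨h1, h2, h3, h4⟩ ⟨x', y'⟩ ⟨h1', h2', h3', h4'⟩ s t hs ht hst
    have hcv := hconv.2 (Set.mem_univ x) (Set.mem_univ x') hs ht hst
    obtain rfl : s = 1 - t := by linarith
    simp only [smul_eq_mul] at *
    refine ⟨?_, ?_, ?_, ?_⟩ <;> simp only [Prod.smul_mk, Prod.mk_add_mk, smul_eq_mul] <;>
      nlinarith only [hcv, mul_le_mul_of_nonneg_left h1 hs, mul_le_mul_of_nonneg_left h1' ht,
        mul_le_mul_of_nonneg_left h2 hs, mul_le_mul_of_nonneg_left h2' ht,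
        mul_le_mul_of_nonneg_left h3 hs, mul_le_mul_of_nonneg_left h3' ht,
        mul_le_mul_of_nonneg_left h4 hs, mul_le_mul_of_nonneg_left h4' ht]
  have hm : MeasurableSet K := by
    have := hfc.measurable
    measurability
  have hne : K.Nonempty := ⟨(ℓ, f ℓ), le_rfl, hℓu.le, le_rfl, by simp⟩
  have harea : volume K = ENNReal.ofReal (∫ x in ℓ..u, (f ℓ + c * (x - ℓ) - f x)) :=
    volume_region_between_Icc hℓu.le hfc (by fun_prop) fun x hx => hconv.le_chord hℓu hx
  have hint : ∫ x in ℓ..u, (f ℓ + c * (x - ℓ) - f x) =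
      (u - ℓ) * (b ^ u + b ^ ℓ) / 2 - (b ^ u - b ^ ℓ) / Real.log b := by
    have hi {g : ℝ → ℝ} (hg : Continuous g) : IntervalIntegrable g volume ℓ u :=
      hg.intervalIntegrable _ _
    have hd : u - ℓ ≠ 0 := (sub_pos.2 hℓu).ne'
    have hsq : c * (u - ℓ) = b ^ u - b ^ ℓ := by
      rw [hc, div_mul_cancel₀ _ hd, hf, hf]
      ring
    rw [intervalIntegral.integral_sub (hi (by fun_prop)) (hi hfc),
      intervalIntegral.integral_add (hi (by fun_prop)) (hi (by fun_prop)),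
      intervalIntegral.integral_const_mul,
      intervalIntegral.integral_sub (hi (by fun_prop)) (hi (by fun_prop))]
    simp_rw [hf]
    rw [intervalIntegral.integral_add (hi hpow) (hi (by fun_prop)), integral_const_rpow hb]
    simp only [intervalIntegral.integral_const, integral_id, smul_eq_mul]
    linear_combination (u - ℓ) / 2 * hsq
  refine (volume_convexHull_origin_union_height_one hK hm hne).trans ?_
  rw [harea, hint, ← ENNReal.ofReal_mul (by norm_num)]
  congr 1
  field_simp
  ring
end

section
/- Let 0 < ℓ < u be real numbers and let f : ℝ → ℝ satisfy 0 ≤ f(ℓ) ≤ f(u). Then the convex hull of the four points (0,0,0), (ℓ,f(ℓ),1), (ℓ,f(u),1), (u,f(u),1) in ℝ³ is exactly the set {(x,y,z) ∈ ℝ³ : L(x,z) ≤ y ≤ z·f(u), ℓ·z ≤ x ≤ u·z, 0 ≤ z ≤ 1}, where L(x,z) := (f(ℓ) − ((f(u)−f(ℓ))/(u−ℓ))·ℓ)·z + ((f(u)−f(ℓ))/(u−ℓ))·x. -/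
theorem simplex_description (ℓ u : ℝ) (f : ℝ → ℝ)
    (hℓ : 0 < ℓ) (hℓu : ℓ < u) (hfl : 0 ≤ f ℓ) (hflu : f ℓ ≤ f u) :
    convexHull ℝ
      ({((0:ℝ), (0:ℝ), (0:ℝ)), (ℓ, f ℓ, (1:ℝ)), (ℓ, f u, (1:ℝ)), (u, f u, (1:ℝ))} :
        Set (ℝ × ℝ × ℝ))
    = {q : ℝ × ℝ × ℝ |
        (f ℓ - (f u - f ℓ) / (u - ℓ) * ℓ) * q.2.2 + (f u - f ℓ) / (u - ℓ) * q.1 ≤ q.2.1 ∧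
        q.2.1 ≤ q.2.2 * f u ∧
        ℓ * q.2.2 ≤ q.1 ∧ q.1 ≤ u * q.2.2 ∧
        0 ≤ q.2.2 ∧ q.2.2 ≤ 1} := by
  have hul : 0 < u - ℓ := sub_pos.mpr hℓu
  apply Set.Subset.antisymm
  · refine convexHull_min ?_ ?_
    · have hu : (f u - f ℓ) / (u - ℓ) * (u - ℓ) = f u - f ℓ := div_mul_cancel₀ _ hul.ne'
      rintro q (rfl | rfl | rfl | rfl) <;> refine ⟨?_, ?_, ?_, ?_, ?_, ?_⟩ <;> dsimp only <;>
        linarith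
    · rintro ⟨x, y, z⟩ ⟨h1, h2, h3, h4, h5, h6⟩ ⟨x', y', z'⟩ ⟨k1, k2, k3, k4, k5, k6⟩ a b ha hb hab
      refine ⟨?_, ?_, ?_, ?_, ?_, ?_⟩ <;>
        simp only [Prod.smul_mk, Prod.mk_add_mk, smul_eq_mul] at *
      · linear_combination a * h1 + b * k1
      · linear_combination a * h2 + b * k2
      · linear_combination a * h3 + b * k3
      · linear_combination a * h4 + b * k4
      · positivity
      · linear_combination a * h6 + b * k6 + hab
  · rintro ⟨x, y, z⟩ ⟨h1, h2, h3, h4, h5, h6⟩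
    dsimp only at h1 h2 h3 h4 h5 h6
    obtain ⟨c, hc⟩ : ∃ c, c = (x - ℓ * z) / (u - ℓ) := ⟨_, rfl⟩
    have hx : c * (u - ℓ) = x - ℓ * z := by rw [hc, div_mul_cancel₀ _ hul.ne']
    have hc0 : 0 ≤ c := hc ▸ div_nonneg (sub_nonneg.mpr h3) hul.le
    have hcz : c ≤ z := by
      rw [hc, div_le_iff₀ hul]
      linarith
    have hL : f ℓ * z + (f u - f ℓ) * c ≤ y := by
      refine le_of_eq_of_le ?_ h1
      rw [hc]
      ring
    obtain ⟨a, ha0, haz, ha⟩ : ∃ a, 0 ≤ a ∧ a ≤ z - c ∧ a * (f u - f ℓ) = z * f u - y := by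
      rcases hflu.eq_or_lt with h | h
      · refine ⟨0, le_rfl, sub_nonneg.mpr hcz, ?_⟩
        rw [h] at hL
        linarith
      · have hd : 0 < f u - f ℓ := sub_pos.mpr h
        refine ⟨(z * f u - y) / (f u - f ℓ), div_nonneg (sub_nonneg.mpr h2) hd.le, ?_,
          div_mul_cancel₀ _ hd.ne'⟩
        rw [div_le_iff₀ hd]
        linarith
    let p : Fin 4 → ℝ × ℝ × ℝ := ![(0, 0, 0), (ℓ, f ℓ, 1), (ℓ, f u, 1), (u, f u, 1)]
    let w : Fin 4 → ℝ := ![1 - z, a, z - c - a, c]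
    have hq : (x, y, z) = ∑ i, w i • p i := by
      simp only [Fin.sum_univ_four, w, p, Matrix.cons_val, Prod.smul_mk, Prod.mk_add_mk,
        smul_eq_mul, Prod.mk.injEq]
      refine ⟨?_, ?_, ?_⟩
      · linear_combination -hx
      · linear_combination ha
      · ring
    rw [hq]
    refine (convex_convexHull ℝ _).sum_mem ?_ ?_ fun i _ => subset_convexHull ℝ _ ?_
    · intro i _
      fin_cases i <;> simp only [w] <;> simp <;> linarith
    · simp only [Fin.sum_univ_four, w, Matrix.cons_val]
      ring
    · fin_cases i <;> simp [p]
end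

section
/- Let 0 < ℓ < u and let f : ℝ → ℝ be continuous, convex, and strictly increasing on [0,u] with f(0) = 0, and let f⁻¹ denote a function satisfying f⁻¹(f(x)) = x for all x ∈ [0,u] and f(f⁻¹(y)) = y for all y ∈ [0,f(u)]. Then the 3-dimensional Lebesgue volume of bar S⁰_f(ℓ,u) := {(x,y,z) ∈ ℝ³ : f(x) ≤ y ≤ z·f(u), ℓ·z ≤ x ≤ u·z, 0 ≤ z ≤ 1} equals ∫_0^{f(ℓ)} [ ∫_{y/f(u)}^{f⁻¹(y)/u} (u−ℓ)·z dz + ∫_{f⁻¹(y)/u}^{f⁻¹(y)/ℓ} (f⁻¹(y) − ℓ·z) dz ] dy + ∫_{f(ℓ)}^{f(u)} [ ∫_{y/f(u)}^{f⁻¹(y)/u} (u−ℓ)·z dz + ∫_{f⁻¹(y)/u}^{1} (f⁻¹(y) − ℓ·z) dz ] dy. -/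
open MeasureTheory

/-- The area of the planar region under `x ≤ w` inside the wedge `ℓ z ≤ x ≤ u z`, `a ≤ z ≤ 1`. -/
theorem volume_truncated_wedge {ℓ u a w b : ℝ} (hℓ : 0 < ℓ) (hℓu : ℓ < u) (ha : 0 ≤ a)
    (haw : a ≤ w / u) (hwb : w / u ≤ b) (hb : b = min 1 (w / ℓ)) :
    volume {p : ℝ × ℝ | a ≤ p.1 ∧ p.1 ≤ 1 ∧ ℓ * p.1 ≤ p.2 ∧ p.2 ≤ u * p.1 ∧ p.2 ≤ w}
      = ENNReal.ofReal ((∫ z in a..(w / u), (u - ℓ) * z) + ∫ z in (w / u)..b, (w - ℓ * z)) := by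
  have hu : 0 < u := hℓ.trans hℓu
  have hb1 : b ≤ 1 := hb ▸ min_le_left _ _
  have hbw : b ≤ w / ℓ := hb ▸ min_le_right _ _
  have hmeas : MeasurableSet
      {p : ℝ × ℝ | a ≤ p.1 ∧ p.1 ≤ 1 ∧ ℓ * p.1 ≤ p.2 ∧ p.2 ≤ u * p.1 ∧ p.2 ≤ w} := by
    measurability
  have hslice : ∀ z : ℝ, volume (Prod.mk z ⁻¹'
      {p : ℝ × ℝ | a ≤ p.1 ∧ p.1 ≤ 1 ∧ ℓ * p.1 ≤ p.2 ∧ p.2 ≤ u * p.1 ∧ p.2 ≤ w})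
      = (Set.Icc a b).indicator (fun z => ENNReal.ofReal (min (u * z) w - ℓ * z)) z := by
    intro z
    by_cases hz : z ∈ Set.Icc a b
    · rw [Set.indicator_of_mem hz, ← Real.volume_Icc]
      congr 1
      ext x
      have := hz.2.trans hb1
      simp [hz.1, this]
    · rw [Set.indicator_of_notMem hz]
      convert measure_empty (μ := (volume : Measure ℝ))
      rw [Set.eq_empty_iff_forall_notMem]
      rintro x ⟨h1, h2, h3, -, h5⟩
      refine hz ⟨h1, hb ▸ le_min h2 ?_⟩
      rw [le_div_iff₀ hℓ]
      linarith
  have hnonneg : ∀ z ∈ Set.Icc a b, 0 ≤ min (u * z) w - ℓ * z := by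
    intro z hz
    have h0 : 0 ≤ z := ha.trans hz.1
    have h2 := (le_div_iff₀ hℓ).1 (hz.2.trans hbw)
    rw [sub_nonneg]
    exact le_min (by gcongr) (by linarith)
  have hcont : Continuous fun z : ℝ => min (u * z) w - ℓ * z := by fun_prop
  rw [Measure.volume_eq_prod, Measure.prod_apply hmeas]
  simp_rw [hslice]
  rw [lintegral_indicator measurableSet_Icc,
    ← ofReal_integral_eq_lintegral_ofReal hcont.continuousOn.integrableOn_Icc
      ((ae_restrict_iff' measurableSet_Icc).2 (.of_forall hnonneg)),
    integral_Icc_eq_integral_Ioc, ← intervalIntegral.integral_of_le (haw.trans hwb),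
    ← intervalIntegral.integral_add_adjacent_intervals (hcont.intervalIntegrable a (w / u))
      (hcont.intervalIntegrable (w / u) b)]
  congr 2
  · refine intervalIntegral.integral_congr fun z hz => ?_
    rw [Set.uIcc_of_le haw] at hz
    have := (le_div_iff₀ hu).1 hz.2
    rw [min_eq_left (by linarith)]
    ring
  · refine intervalIntegral.integral_congr fun z hz => ?_
    rw [Set.uIcc_of_le hwb] at hz
    have := (div_le_iff₀ hu).1 hz.1
    rw [min_eq_right (by linarith)]

/-- Cyclically permuting the coordinates of a triple of reals preserves volume. -/
theorem measurePreserving_rotate_triple :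
    MeasurePreserving (fun q : ℝ × ℝ × ℝ => (q.2.1, q.2.2, q.1)) volume volume :=
  (measurePreserving_prodAssoc (volume : Measure ℝ) (volume : Measure ℝ) (volume : Measure ℝ)).comp
    (Measure.measurePreserving_swap (μ := (volume : Measure ℝ)) (ν := (volume : Measure (ℝ × ℝ))))

open MeasureTheory

theorem naive_bar_volume (ℓ u : ℝ) (f finv : ℝ → ℝ)
    (hℓ : 0 < ℓ) (hℓu : ℓ < u)
    (hf_cont : ContinuousOn f (Set.Icc 0 u))
    (hf_conv : ConvexOn ℝ (Set.Icc 0 u) f)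
    (hf_mono : StrictMonoOn f (Set.Icc 0 u))
    (hf0 : f 0 = 0)
    (hinv_left : ∀ x ∈ Set.Icc 0 u, finv (f x) = x)
    (hinv_right : ∀ y ∈ Set.Icc 0 (f u), f (finv y) = y) :
    volume {q : ℝ × ℝ × ℝ | f q.1 ≤ q.2.1 ∧ q.2.1 ≤ q.2.2 * f u ∧
        ℓ * q.2.2 ≤ q.1 ∧ q.1 ≤ u * q.2.2 ∧ 0 ≤ q.2.2 ∧ q.2.2 ≤ 1}
    = ENNReal.ofReal
        ((∫ y in (0:ℝ)..(f ℓ),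
            ((∫ z in (y / f u)..(finv y / u), (u - ℓ) * z)
              + ∫ z in (finv y / u)..(finv y / ℓ), (finv y - ℓ * z)))
         + ∫ y in (f ℓ)..(f u),
            ((∫ z in (y / f u)..(finv y / u), (u - ℓ) * z)
              + ∫ z in (finv y / u)..(1:ℝ), (finv y - ℓ * z))) := by
  have hu : 0 < u := hℓ.trans hℓu
  have h0mem : (0 : ℝ) ∈ Set.Icc 0 u := ⟨le_rfl, hu.le⟩
  have humem : u ∈ Set.Icc 0 u := ⟨hu.le, le_rfl⟩
  have hℓmem : ℓ ∈ Set.Icc 0 u := ⟨hℓ.le, hℓu.le⟩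
  have hfℓ : 0 < f ℓ := hf0 ▸ hf_mono h0mem hℓmem hℓ
  have hfℓu : f ℓ < f u := hf_mono hℓmem humem hℓu
  have hfu : 0 < f u := hfℓ.trans hfℓu
  have hfinv_mem : ∀ y ∈ Set.Icc 0 (f u), finv y ∈ Set.Icc 0 u := by
    intro y hy
    obtain ⟨x, hx, rfl⟩ := intermediate_value_Icc hu.le hf_cont (by rwa [hf0])
    rwa [hinv_left x hx]
  have hchord : ∀ y ∈ Set.Icc 0 (f u), y / f u ≤ finv y / u := by
    intro y hy
    obtain ⟨hw0, hwu⟩ := hfinv_mem y hy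
    have h := hf_conv.2 humem h0mem (div_nonneg hw0 hu.le)
      (sub_nonneg.2 ((div_le_one hu).2 hwu)) (by ring)
    simp only [smul_eq_mul, mul_zero, add_zero, hf0, div_mul_cancel₀ _ hu.ne',
      hinv_right y hy] at h
    rwa [div_le_iff₀ hfu]
  let T : Set (ℝ × ℝ × ℝ) := {p | f p.2.2 ≤ p.1 ∧ p.1 ≤ p.2.1 * f u ∧
    ℓ * p.2.1 ≤ p.2.2 ∧ p.2.2 ≤ u * p.2.1 ∧ 0 ≤ p.2.1 ∧ p.2.1 ≤ 1}
  have hx_mem : ∀ {z x : ℝ}, ℓ * z ≤ x → x ≤ u * z → 0 ≤ z → z ≤ 1 → x ∈ Set.Icc 0 u := by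
    intro z x h1 h2 h3 h4
    exact ⟨(mul_nonneg hℓ.le h3).trans h1, h2.trans (mul_le_of_le_one_right hu.le h4)⟩
  have hT_meas : MeasurableSet T := by
    have hg : Continuous fun x : ℝ => f (max 0 (min u x)) :=
      hf_cont.comp_continuous (by fun_prop)
        fun x => ⟨le_max_left _ _, max_le hu.le (min_le_left _ _)⟩
    have hTg : T = {p | f (max 0 (min u p.2.2)) ≤ p.1 ∧ p.1 ≤ p.2.1 * f u ∧
        ℓ * p.2.1 ≤ p.2.2 ∧ p.2.2 ≤ u * p.2.1 ∧ 0 ≤ p.2.1 ∧ p.2.1 ≤ 1} := by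
      ext ⟨y, z, x⟩
      refine and_congr_left fun ⟨_, h1, h2, h3, h4⟩ => ?_
      obtain ⟨h5, h6⟩ := hx_mem h1 h2 h3 h4
      simp only at h5 h6
      simp [h5, h6]
    rw [hTg]
    have hg' : Measurable fun p : ℝ × ℝ × ℝ => f (max 0 (min u p.2.2)) :=
      hg.measurable.comp measurable_snd.snd
    have hbox : MeasurableSet {p : ℝ × ℝ × ℝ | p.1 ≤ p.2.1 * f u ∧
        ℓ * p.2.1 ≤ p.2.2 ∧ p.2.2 ≤ u * p.2.1 ∧ 0 ≤ p.2.1 ∧ p.2.1 ≤ 1} := by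
      measurability
    exact (measurableSet_le hg' measurable_fst).inter hbox
  have hmem_y : ∀ {y z x : ℝ}, (y, z, x) ∈ T → y ∈ Set.Icc 0 (f u) := by
    rintro y z x ⟨h1, h2, h3, h4, h5, h6⟩
    have hx := hx_mem h3 h4 h5 h6
    have hfx := hf_mono.monotoneOn h0mem hx hx.1
    simp only at h1 h2 h6
    exact ⟨by linarith, h2.trans (mul_le_of_le_one_left hfu.le h6)⟩
  have hslice : ∀ y ∈ Set.Icc 0 (f u), Prod.mk y ⁻¹' T = {p : ℝ × ℝ | y / f u ≤ p.1 ∧ p.1 ≤ 1 ∧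
      ℓ * p.1 ≤ p.2 ∧ p.2 ≤ u * p.1 ∧ p.2 ≤ finv y} := by
    rintro y hy
    ext ⟨z, x⟩
    have key : x ∈ Set.Icc 0 u → (f x ≤ y ↔ x ≤ finv y) := fun hx => by
      conv_lhs => rw [← hinv_right y hy]
      exact hf_mono.le_iff_le hx (hfinv_mem y hy)
    constructor
    · rintro ⟨h1, h2, h3, h4, h5, h6⟩
      exact ⟨(div_le_iff₀ hfu).2 h2, h6, h3, h4, (key (hx_mem h3 h4 h5 h6)).1 h1⟩
    · rintro ⟨h1, h2, h3, h4, h5⟩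
      have h0 : 0 ≤ z := (div_nonneg hy.1 hfu.le).trans h1
      exact ⟨(key (hx_mem h3 h4 h0 h2)).2 h5, (div_le_iff₀ hfu).1 h1, h3, h4, h0, h2⟩
  have hvol_low : ∀ y ∈ Set.Icc 0 (f ℓ), volume (Prod.mk y ⁻¹' T) = ENNReal.ofReal
      ((∫ z in (y / f u)..(finv y / u), (u - ℓ) * z)
        + ∫ z in (finv y / u)..(finv y / ℓ), (finv y - ℓ * z)) := by
    intro y hy
    have hy' : y ∈ Set.Icc 0 (f u) := ⟨hy.1, hy.2.trans hfℓu.le⟩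
    have hw := hfinv_mem y hy'
    have hwℓ : finv y ≤ ℓ := by
      rw [← hf_mono.le_iff_le hw hℓmem, hinv_right y hy']
      exact hy.2
    rw [hslice y hy']
    exact volume_truncated_wedge hℓ hℓu (div_nonneg hy.1 hfu.le) (hchord y hy')
      (div_le_div_of_nonneg_left hw.1 hℓ hℓu.le) (min_eq_right ((div_le_one hℓ).2 hwℓ)).symm
  have hvol_high : ∀ y ∈ Set.Icc (f ℓ) (f u), volume (Prod.mk y ⁻¹' T) = ENNReal.ofReal
      ((∫ z in (y / f u)..(finv y / u), (u - ℓ) * z)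
        + ∫ z in (finv y / u)..(1:ℝ), (finv y - ℓ * z)) := by
    intro y hy
    have hy' : y ∈ Set.Icc 0 (f u) := ⟨hfℓ.le.trans hy.1, hy.2⟩
    have hw := hfinv_mem y hy'
    have hwℓ : ℓ ≤ finv y := by
      rw [← hf_mono.le_iff_le hℓmem hw, hinv_right y hy']
      exact hy.1
    rw [hslice y hy']
    exact volume_truncated_wedge hℓ hℓu (div_nonneg hy'.1 hfu.le) (hchord y hy')
      ((div_le_one hu).2 hw.2) (min_eq_left ((one_le_div hℓ).2 hwℓ)).symm
  have hT_lt_top : volume T < ⊤ := by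
    refine (measure_mono ?_).trans_lt
      (isCompact_Icc (a := ((0, 0, 0) : ℝ × ℝ × ℝ)) (b := (f u, 1, u))).measure_lt_top
    rintro ⟨y, z, x⟩ h
    have hy := hmem_y h
    obtain ⟨-, -, h3, h4, h5, h6⟩ := h
    have hx := hx_mem h3 h4 h5 h6
    exact ⟨⟨hy.1, h5, hx.1⟩, ⟨hy.2, h6, hx.2⟩⟩
  have hprod : volume T = ∫⁻ y, volume (Prod.mk y ⁻¹' T) := by
    rw [Measure.volume_eq_prod, Measure.prod_apply hT_meas]
  have hslice_meas : Measurable fun y : ℝ => volume (Prod.mk y ⁻¹' T) :=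
    measurable_measure_prodMk_left hT_meas
  have hint : Integrable (fun y : ℝ => (volume (Prod.mk y ⁻¹' T)).toReal) :=
    integrable_toReal_of_lintegral_ne_top hslice_meas.aemeasurable (hprod ▸ hT_lt_top.ne)
  have hzero : ∀ y ∉ Set.Icc 0 (f u), (volume (Prod.mk y ⁻¹' T)).toReal = 0 := by
    intro y hy
    have : Prod.mk y ⁻¹' T = ∅ :=
      Set.eq_empty_iff_forall_notMem.2 fun _ hp => hy (hmem_y hp)
    simp [this]
  have hT_vol : volume T = ENNReal.ofReal (∫ y in (0:ℝ)..(f u),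
      (volume (Prod.mk y ⁻¹' T)).toReal) := by
    rw [intervalIntegral.integral_of_le hfu.le, ← integral_Icc_eq_integral_Ioc,
      setIntegral_eq_integral_of_forall_compl_eq_zero hzero,
      integral_toReal hslice_meas.aemeasurable (ae_lt_top hslice_meas (hprod ▸ hT_lt_top.ne)),
      ← hprod, ENNReal.ofReal_toReal hT_lt_top.ne]
  have hinner : ∀ {y b : ℝ}, y ∈ Set.Icc 0 (f u) → finv y / u ≤ b → b ≤ finv y / ℓ →
      0 ≤ (∫ z in (y / f u)..(finv y / u), (u - ℓ) * z)
        + ∫ z in (finv y / u)..b, (finv y - ℓ * z) := by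
    intro y b hy h1 h2
    refine add_nonneg (intervalIntegral.integral_nonneg (hchord y hy) fun z hz => ?_)
      (intervalIntegral.integral_nonneg h1 fun z hz => ?_)
    · exact mul_nonneg (sub_nonneg.2 hℓu.le) ((div_nonneg hy.1 hfu.le).trans hz.1)
    · have := (le_div_iff₀ hℓ).1 (hz.2.trans h2)
      linarith
  have hrot : volume {q : ℝ × ℝ × ℝ | f q.1 ≤ q.2.1 ∧ q.2.1 ≤ q.2.2 * f u ∧
      ℓ * q.2.2 ≤ q.1 ∧ q.1 ≤ u * q.2.2 ∧ 0 ≤ q.2.2 ∧ q.2.2 ≤ 1} = volume T :=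
    measurePreserving_rotate_triple.measure_preimage hT_meas.nullMeasurableSet
  rw [hrot, hT_vol, ← intervalIntegral.integral_add_adjacent_intervals
    (hint.intervalIntegrable (a := 0) (b := f ℓ)) (hint.intervalIntegrable (a := f ℓ) (b := f u))]
  congr 2
  · refine intervalIntegral.integral_congr fun y hy => ?_
    rw [Set.uIcc_of_le hfℓ.le] at hy
    have hy' : y ∈ Set.Icc 0 (f u) := ⟨hy.1, hy.2.trans hfℓu.le⟩
    rw [hvol_low y hy, ENNReal.toReal_ofReal]
    exact hinner hy' (div_le_div_of_nonneg_left (hfinv_mem y hy').1 hℓ hℓu.le) le_rfl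
  · refine intervalIntegral.integral_congr fun y hy => ?_
    rw [Set.uIcc_of_le hfℓu.le] at hy
    have hy' : y ∈ Set.Icc 0 (f u) := ⟨hfℓ.le.trans hy.1, hy.2⟩
    have hw := hfinv_mem y hy'
    rw [hvol_high y hy, ENNReal.toReal_ofReal]
    refine hinner hy' ((div_le_one hu).2 hw.2) ((one_le_div hℓ).2 ?_)
    rw [← hf_mono.le_iff_le hℓmem hw, hinv_right y hy']
    exact hy.1
end

section
/- Let 0 < ℓ < u and let f : ℝ → ℝ be continuous, convex, and increasing on [0,u] with f(0) = 0. Then the 3-dimensional Lebesgue volume of invbreve S⁰_f(ℓ,u) := {(x,y,z) ∈ ℝ³ : f(x) ≤ y ≤ L(x,z), ℓ·z ≤ x ≤ u·z, 0 ≤ z ≤ 1}, where L(x,z) := (f(ℓ) − ((f(u)−f(ℓ))/(u−ℓ))·ℓ)·z + ((f(u)−f(ℓ))/(u−ℓ))·x, equals the volume of bar S⁰_f(ℓ,u) := {(x,y,z) ∈ ℝ³ : f(x) ≤ y ≤ z·f(u), ℓ·z ≤ x ≤ u·z, 0 ≤ z ≤ 1} minus (1/6)·(f(u)−f(ℓ))·(u−ℓ).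 -/
open MeasureTheory

/-- The volume of a tetrahedral region cut out by `L(x, z) < y ≤ z * d`, where the gap
`z * d - L(x, z)` equals `m * (u * z - x)`. -/
lemma volume_wedge {l u m c d : ℝ} (hlu : l ≤ u) (hm : 0 ≤ m) (hd : d = c + m * u) :
    volume {q : ℝ × ℝ × ℝ | c * q.2.2 + m * q.1 < q.2.1 ∧ q.2.1 ≤ q.2.2 * d ∧
        l * q.2.2 ≤ q.1 ∧ q.1 ≤ u * q.2.2 ∧ 0 ≤ q.2.2 ∧ q.2.2 ≤ 1}
      = ENNReal.ofReal (m * (u - l) ^ 2 / 6) := by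
  set T : Set (ℝ × ℝ × ℝ) := {p | c * p.1 + m * p.2.1 < p.2.2 ∧ p.2.2 ≤ p.1 * d ∧
    l * p.1 ≤ p.2.1 ∧ p.2.1 ≤ u * p.1 ∧ 0 ≤ p.1 ∧ p.1 ≤ 1} with hT
  have hTm : MeasurableSet T := by
    simp only [hT, Set.ofPred_and]
    refine (measurableSet_lt ?_ ?_).inter <| (measurableSet_le ?_ ?_).inter <|
      (measurableSet_le ?_ ?_).inter <| (measurableSet_le ?_ ?_).inter <|
      (measurableSet_le ?_ ?_).inter (measurableSet_le ?_ ?_) <;> fun_prop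
  have hrot : MeasurePreserving
      (fun q : ℝ × ℝ × ℝ => ((q.2.2, q.1, q.2.1) : ℝ × ℝ × ℝ)) volume volume :=
    (Measure.measurePreserving_swap (μ := (volume : Measure (ℝ × ℝ)))
      (ν := (volume : Measure ℝ))).comp
      ((volume_preserving_prodAssoc (α₁ := ℝ) (β₁ := ℝ) (γ₁ := ℝ)).symm _)
  have hslice (z : ℝ) : volume (Prod.mk z ⁻¹' T)
      = (Set.Icc (0 : ℝ) 1).indicator
          (fun z => ENNReal.ofReal (m * (u - l) ^ 2 * z ^ 2 / 2)) z := by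
    by_cases hz : z ∈ Set.Icc (0 : ℝ) 1
    · have hle : l * z ≤ u * z := mul_le_mul_of_nonneg_right hlu hz.1
      have hfib (x : ℝ) : volume (Prod.mk x ⁻¹' (Prod.mk z ⁻¹' T))
          = (Set.Icc (l * z) (u * z)).indicator
              (fun x => ENNReal.ofReal (m * (u * z - x))) x := by
        by_cases hx : x ∈ Set.Icc (l * z) (u * z)
        · have hset : Prod.mk x ⁻¹' (Prod.mk z ⁻¹' T) = Set.Ioc (c * z + m * x) (z * d) := by
            ext y
            simp [hT, hx.1, hx.2, hz.1, hz.2]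
          rw [hset, Real.volume_Ioc, Set.indicator_of_mem hx, hd]
          congr 1
          ring
        · have hset : Prod.mk x ⁻¹' (Prod.mk z ⁻¹' T) = ∅ := by
            ext y
            simp only [hT, Set.mem_preimage, Set.mem_ofPred_eq, Set.mem_empty_iff_false, iff_false]
            exact fun h => hx ⟨h.2.2.1, h.2.2.2.1⟩
          rw [hset, measure_empty, Set.indicator_of_notMem hx]
      rw [Set.indicator_of_mem hz, Measure.volume_eq_prod,
        Measure.prod_apply (measurable_prodMk_left hTm), lintegral_congr hfib,
        lintegral_indicator measurableSet_Icc, ← ofReal_integral_eq_lintegral_ofReal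
          (Continuous.integrableOn_Icc (by fun_prop))
          ((ae_restrict_iff' measurableSet_Icc).2 (Filter.Eventually.of_forall fun x hx =>
            mul_nonneg hm (sub_nonneg.2 hx.2))),
        integral_Icc_eq_integral_Ioc, ← intervalIntegral.integral_of_le hle,
        intervalIntegral.integral_const_mul, intervalIntegral.integral_sub (by simp) (by simp),
        integral_id, intervalIntegral.integral_const, smul_eq_mul]
      congr 1
      ring
    · have hset : Prod.mk z ⁻¹' T = ∅ := by
        ext y
        simp only [hT, Set.mem_preimage, Set.mem_ofPred_eq, Set.mem_empty_iff_false, iff_false]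
        exact fun h => hz h.2.2.2.2
      rw [hset, measure_empty, Set.indicator_of_notMem hz]
  refine (hrot.measure_preimage hTm.nullMeasurableSet).trans ?_
  rw [Measure.volume_eq_prod, Measure.prod_apply hTm, lintegral_congr hslice,
    lintegral_indicator measurableSet_Icc, ← ofReal_integral_eq_lintegral_ofReal
      (Continuous.integrableOn_Icc (by fun_prop))
      (Filter.Eventually.of_forall fun z => by positivity),
    integral_Icc_eq_integral_Ioc, ← intervalIntegral.integral_of_le zero_le_one,
    intervalIntegral.integral_div, intervalIntegral.integral_const_mul, integral_pow]
  congr 1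
  ring

theorem naive_volume_from_bar (ℓ u : ℝ) (f : ℝ → ℝ)
    (hℓ : 0 < ℓ) (hℓu : ℓ < u)
    (hf_cont : ContinuousOn f (Set.Icc 0 u))
    (hf_conv : ConvexOn ℝ (Set.Icc 0 u) f)
    (hf_mono : MonotoneOn f (Set.Icc 0 u))
    (hf0 : f 0 = 0) :
    (volume {q : ℝ × ℝ × ℝ | f q.1 ≤ q.2.1 ∧
        q.2.1 ≤ (f ℓ - (f u - f ℓ) / (u - ℓ) * ℓ) * q.2.2
                  + (f u - f ℓ) / (u - ℓ) * q.1 ∧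
        ℓ * q.2.2 ≤ q.1 ∧ q.1 ≤ u * q.2.2 ∧ 0 ≤ q.2.2 ∧ q.2.2 ≤ 1}).toReal
    = (volume {q : ℝ × ℝ × ℝ | f q.1 ≤ q.2.1 ∧ q.2.1 ≤ q.2.2 * f u ∧
        ℓ * q.2.2 ≤ q.1 ∧ q.1 ≤ u * q.2.2 ∧ 0 ≤ q.2.2 ∧ q.2.2 ≤ 1}).toReal
      - (1/6) * (f u - f ℓ) * (u - ℓ) := by
  have hu : 0 < u := hℓ.trans hℓu
  have hul : 0 < u - ℓ := sub_pos.2 hℓu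
  have h0_mem : (0 : ℝ) ∈ Set.Icc 0 u := ⟨le_rfl, hu.le⟩
  have hℓ_mem : ℓ ∈ Set.Icc 0 u := ⟨hℓ.le, hℓu.le⟩
  have hu_mem : u ∈ Set.Icc 0 u := ⟨hu.le, le_rfl⟩
  set m := (f u - f ℓ) / (u - ℓ)
  have hmul : m * (u - ℓ) = f u - f ℓ := div_mul_cancel₀ _ hul.ne'
  have hm : 0 ≤ m := div_nonneg (sub_nonneg.2 (hf_mono hℓ_mem hu_mem hℓu.le)) hul.le
  have hfu : 0 ≤ f u := hf0 ▸ hf_mono h0_mem hu_mem hu.le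
  set B : Set (ℝ × ℝ × ℝ) := {q | f q.1 ≤ q.2.1 ∧ q.2.1 ≤ q.2.2 * f u ∧
    ℓ * q.2.2 ≤ q.1 ∧ q.1 ≤ u * q.2.2 ∧ 0 ≤ q.2.2 ∧ q.2.2 ≤ 1} with hB
  set t : Set (ℝ × ℝ × ℝ) := {q | q.2.1 ≤ (f ℓ - m * ℓ) * q.2.2 + m * q.1} with ht
  have htm : MeasurableSet t := measurableSet_le (by fun_prop) (by fun_prop)
  have hf_le_chord {x z : ℝ} (h1 : ℓ * z ≤ x) (h2 : x ≤ u * z) (h3 : 0 ≤ z) (h4 : z ≤ 1) :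
      f x ≤ (f ℓ - m * ℓ) * z + m * x := by
    -- `x` is the convex combination `a * ℓ + b * u + (1 - z) * 0`.
    set b := (x - ℓ * z) / (u - ℓ)
    have hb : b * (u - ℓ) = x - ℓ * z := div_mul_cancel₀ _ hul.ne'
    have hb0 : 0 ≤ b := div_nonneg (sub_nonneg.2 h1) hul.le
    have ha0 : 0 ≤ z - b := by
      by_contra! h
      nlinarith
    have hconv := hf_conv.map_sum_le (t := Finset.univ) (w := ![z - b, b, 1 - z])
      (p := ![ℓ, u, 0])
      (by intro i _; fin_cases i <;> simp <;> linarith)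
      (by simp [Fin.sum_univ_three])
      (by intro i _; fin_cases i <;> assumption)
    simp only [Fin.sum_univ_three, Matrix.cons_val, smul_eq_mul, hf0, mul_zero, add_zero] at hconv
    have hx : (z - b) * ℓ + b * u = x := by linarith
    rw [hx] at hconv
    have hy : (f ℓ - m * ℓ) * z + m * x = (z - b) * f ℓ + b * f u := by
      linear_combination b * hmul - m * hb
    rwa [hy]
  have hinter : B ∩ t = {q : ℝ × ℝ × ℝ | f q.1 ≤ q.2.1 ∧
      q.2.1 ≤ (f ℓ - m * ℓ) * q.2.2 + m * q.1 ∧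
      ℓ * q.2.2 ≤ q.1 ∧ q.1 ≤ u * q.2.2 ∧ 0 ≤ q.2.2 ∧ q.2.2 ≤ 1} := by
    ext ⟨x, y, z⟩
    simp only [hB, ht, Set.mem_inter_iff, Set.mem_ofPred_eq]
    refine ⟨fun ⟨⟨h1, _, h2⟩, h3⟩ => ⟨h1, h3, h2⟩, fun ⟨h1, h2, h3, h4, h5⟩ =>
      ⟨⟨h1, ?_, h3, h4, h5⟩, h2⟩⟩
    linear_combination h2 + m * h4 + z * hmul
  have hdiff : B \ t = {q : ℝ × ℝ × ℝ | (f ℓ - m * ℓ) * q.2.2 + m * q.1 < q.2.1 ∧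
      q.2.1 ≤ q.2.2 * f u ∧ ℓ * q.2.2 ≤ q.1 ∧ q.1 ≤ u * q.2.2 ∧ 0 ≤ q.2.2 ∧ q.2.2 ≤ 1} := by
    ext ⟨x, y, z⟩
    simp only [hB, ht, Set.mem_sdiff, Set.mem_ofPred_eq, not_le]
    exact ⟨fun ⟨⟨_, h1⟩, h2⟩ => ⟨h2, h1⟩, fun ⟨h1, h2, h3, h4, h5, h6⟩ =>
      ⟨⟨(hf_le_chord h3 h4 h5 h6).trans h1.le, h2, h3, h4, h5, h6⟩, h1⟩⟩
  have hB_fin : volume B ≠ ⊤ := by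
    refine measure_ne_top_of_subset (s := Set.Icc ((0, 0, 0) : ℝ × ℝ × ℝ) (u, f u, 1)) ?_
      isCompact_Icc.measure_lt_top.ne
    rintro ⟨x, y, z⟩ ⟨h1, h2, h3, h4, h5, h6⟩
    dsimp only at h1 h2 h3 h4 h5 h6
    have hx0 : 0 ≤ x := (mul_nonneg hℓ.le h5).trans h3
    have hxu : x ≤ u := h4.trans (mul_le_of_le_one_right hu.le h6)
    have hfx : 0 ≤ f x := hf0 ▸ hf_mono h0_mem ⟨hx0, hxu⟩ hx0
    exact ⟨⟨hx0, hfx.trans h1, h5⟩, ⟨hxu, h2.trans (mul_le_of_le_one_left hfu h6), h6⟩⟩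
  have hwedge := volume_wedge (c := f ℓ - m * ℓ) (d := f u) hℓu.le hm
    (by linear_combination -hmul)
  have hsum := measureReal_inter_add_sdiff (μ := volume) htm hB_fin
  simp only [measureReal_def] at hsum
  rw [← hinter, ← hsum, hdiff, hwedge, ENNReal.toReal_ofReal (by positivity)]
  linear_combination (-(u - ℓ) / 6) * hmul
end

section
/- Let b > 1 and 0 < ℓ < u, and let f(x) := b^x − 1. Then the 3-dimensional Lebesgue volume of invbreve S⁰_f(ℓ,u) := {(x,y,z) ∈ ℝ³ : f(x) ≤ y ≤ L(x,z), ℓ·z ≤ x ≤ u·z, 0 ≤ z ≤ 1}, where L(x,z) := (f(ℓ) − ((f(u)−f(ℓ))/(u−ℓ))·ℓ)·z + ((f(u)−f(ℓ))/(u−ℓ))·x, equals (1/6)·(u−ℓ)·(b^u + b^ℓ + 1) − (1/(log b)²)·((b^u − 1)/u − (b^ℓ − 1)/ℓ). -/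
open MeasureTheory

theorem lintegral_Icc_ofReal_of_hasDerivAt {F g : ℝ → ℝ} {a c : ℝ} (hac : a ≤ c)
    (hF : ∀ x, HasDerivAt F (g x) x) (hg : Continuous g) (h0 : ∀ x ∈ Set.Icc a c, 0 ≤ g x) :
    ∫⁻ x in Set.Icc a c, ENNReal.ofReal (g x) = ENNReal.ofReal (F c - F a) := by
  rw [← intervalIntegral.integral_eq_sub_of_hasDerivAt (fun x _ => hF x)
      (hg.intervalIntegrable a c), intervalIntegral.integral_of_le hac,
    ← integral_Icc_eq_integral_Ioc, ofReal_integral_eq_lintegral_ofReal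
      (hg.continuousOn.integrableOn_Icc)]
  exact (ae_restrict_iff' measurableSet_Icc).2 (Filter.Eventually.of_forall h0)

theorem sub_nonneg_of_hasDerivAt_nonneg {F g : ℝ → ℝ} {a c : ℝ} (hac : a ≤ c)
    (hF : ∀ x, HasDerivAt F (g x) x) (hg : Continuous g) (h0 : ∀ x ∈ Set.Icc a c, 0 ≤ g x) :
    0 ≤ F c - F a := by
  rw [← intervalIntegral.integral_eq_sub_of_hasDerivAt (fun x _ => hF x)
      (hg.intervalIntegrable a c)]
  exact intervalIntegral.integral_nonneg hac h0

/-- On the cone over `[ℓ, u]`, the perspective of the secant dominates a convex function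
vanishing at the origin. -/
theorem ConvexOn.le_secant_perspective {f : ℝ → ℝ} (hf : ConvexOn ℝ Set.univ f) (hf0 : f 0 = 0)
    {ℓ u x z : ℝ} (hℓu : ℓ < u) (hz0 : 0 ≤ z) (hz1 : z ≤ 1) (h1 : ℓ * z ≤ x) (h2 : x ≤ u * z) :
    f x ≤ (f ℓ - (f u - f ℓ) / (u - ℓ) * ℓ) * z + (f u - f ℓ) / (u - ℓ) * x := by
  rcases hz0.eq_or_lt with rfl | hz
  · obtain rfl : x = 0 := by linarith
    simp [hf0]
  obtain ⟨w, rfl⟩ : ∃ w, x = z * w := ⟨x / z, by field_simp⟩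
  have hw1 : ℓ ≤ w := le_of_mul_le_mul_left (by linarith) hz
  have hw2 : w ≤ u := le_of_mul_le_mul_left (by linarith) hz
  have hd : 0 < u - ℓ := sub_pos.2 hℓu
  have hA := hf.2 (Set.mem_univ 0) (Set.mem_univ w) (sub_nonneg.2 hz1) hz0 (by ring)
  have hB := hf.2 (Set.mem_univ ℓ) (Set.mem_univ u)
    (div_nonneg (sub_nonneg.2 hw2) hd.le : 0 ≤ (u - w) / (u - ℓ))
    (div_nonneg (sub_nonneg.2 hw1) hd.le : 0 ≤ (w - ℓ) / (u - ℓ)) (by field_simp; ring)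
  simp only [smul_eq_mul, hf0, mul_zero, zero_add] at hA hB
  have hw : (u - w) / (u - ℓ) * ℓ + (w - ℓ) / (u - ℓ) * u = w := by field_simp; ring
  rw [hw] at hB
  refine hA.trans ((mul_le_mul_of_nonneg_left hB hz0).trans_eq ?_)
  field_simp
  ring

theorem hasDerivAt_exp_const_mul (c x : ℝ) :
    HasDerivAt (fun t => Real.exp (c * t)) (c * Real.exp (c * x)) x := by
  simpa [mul_comm] using ((hasDerivAt_id x).const_mul c).exp

/-- Fubini for sets of `(x, y, z)`, integrating over `z` last. -/
theorem volume_eq_lintegral_lintegral_section {S : Set (ℝ × ℝ × ℝ)} (hS : MeasurableSet S) :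
    volume S = ∫⁻ z, ∫⁻ x, volume {y : ℝ | (x, y, z) ∈ S} := by
  have h1 : MeasurePreserving (MeasurableEquiv.prodAssoc : (ℝ × ℝ) × ℝ ≃ᵐ ℝ × ℝ × ℝ) :=
    volume_preserving_prodAssoc
  have h2 : MeasurePreserving (Prod.swap : ℝ × (ℝ × ℝ) → (ℝ × ℝ) × ℝ) :=
    Measure.measurePreserving_swap
  have h3 := h1.comp h2
  rw [← h3.measure_preimage hS.nullMeasurableSet, Measure.volume_eq_prod,
    Measure.prod_apply (h3.measurable hS)]
  refine lintegral_congr fun z => ?_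
  rw [Measure.volume_eq_prod, Measure.prod_apply (measurable_prodMk_left (h3.measurable hS))]
  rfl

/-- The volume between `x ↦ exp (k * x) - 1` and an affine-homogeneous upper bound over a cone. -/
theorem volume_exp_le_linear_cone {k ℓ u α m : ℝ} (hk : 0 < k) (hℓ : 0 < ℓ) (hℓu : ℓ < u)
    (hle : ∀ x z, 0 ≤ z → z ≤ 1 → ℓ * z ≤ x → x ≤ u * z →
      Real.exp (k * x) - 1 ≤ α * z + m * x) :
    volume {q : ℝ × ℝ × ℝ | Real.exp (k * q.1) - 1 ≤ q.2.1 ∧ q.2.1 ≤ α * q.2.2 + m * q.1 ∧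
        ℓ * q.2.2 ≤ q.1 ∧ q.1 ≤ u * q.2.2 ∧ 0 ≤ q.2.2 ∧ q.2.2 ≤ 1}
    = ENNReal.ofReal ((α * (u - ℓ) + m * (u ^ 2 - ℓ ^ 2) / 2) / 3 + (u - ℓ) / 2
        - ((Real.exp (k * u) - 1) / u - (Real.exp (k * ℓ) - 1) / ℓ) / k ^ 2) := by
  have hu : 0 < u := hℓ.trans hℓu
  have hcz : ∀ z, 0 ≤ z → ℓ * z ≤ u * z := fun z hz => mul_le_mul_of_nonneg_right hℓu.le hz
  have hmeas : MeasurableSet {q : ℝ × ℝ × ℝ | Real.exp (k * q.1) - 1 ≤ q.2.1 ∧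
      q.2.1 ≤ α * q.2.2 + m * q.1 ∧ ℓ * q.2.2 ≤ q.1 ∧ q.1 ≤ u * q.2.2 ∧ 0 ≤ q.2.2 ∧ q.2.2 ≤ 1} := by
    measurability
  let g : ℝ → ℝ → ℝ := fun z x => α * z + m * x - (Real.exp (k * x) - 1)
  let F : ℝ → ℝ → ℝ := fun z x => α * z * x + m * x ^ 2 / 2 - (Real.exp (k * x) / k - x)
  let H : ℝ → ℝ := fun z => (α * (u - ℓ) + m * (u ^ 2 - ℓ ^ 2) / 2) * z ^ 3 / 3
    + (u - ℓ) * z ^ 2 / 2 - (Real.exp (k * u * z) / u - Real.exp (k * ℓ * z) / ℓ) / k ^ 2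
  have hF : ∀ z x, HasDerivAt (F z) (g z x) x := fun z x => by
    refine HasDerivAt.congr_deriv (f := F z) ((((hasDerivAt_id x).const_mul (α * z)).add
      (((hasDerivAt_pow 2 x).const_mul m).div_const 2)).sub
      (((hasDerivAt_exp_const_mul k x).div_const k).sub (hasDerivAt_id x))) ?_
    simp only [g]
    field_simp
    ring
  have hg : ∀ z, Continuous (g z) := fun z => by fun_prop
  have hg0 : ∀ z ∈ Set.Icc (0 : ℝ) 1, ∀ x ∈ Set.Icc (ℓ * z) (u * z), 0 ≤ g z x :=
    fun z hz x hx => sub_nonneg.2 (hle x z hz.1 hz.2 hx.1 hx.2)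
  have hH : ∀ z, HasDerivAt H (F z (u * z) - F z (ℓ * z)) z := fun z => by
    refine HasDerivAt.congr_deriv (f := H) (((((hasDerivAt_pow 3 z).const_mul (α * (u - ℓ) + m * (u ^ 2 - ℓ ^ 2) / 2)).div_const
      3).add (((hasDerivAt_pow 2 z).const_mul (u - ℓ)).div_const 2)).sub
      ((((hasDerivAt_exp_const_mul (k * u) z).div_const u).sub
      ((hasDerivAt_exp_const_mul (k * ℓ) z).div_const ℓ)).div_const (k ^ 2))) ?_
    simp only [F, ← mul_assoc]
    field_simp
    ring
  have hinner : ∀ z x, volume {y : ℝ | (x, y, z) ∈ {q : ℝ × ℝ × ℝ | Real.exp (k * q.1) - 1 ≤ q.2.1 ∧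
      q.2.1 ≤ α * q.2.2 + m * q.1 ∧ ℓ * q.2.2 ≤ q.1 ∧ q.1 ≤ u * q.2.2 ∧ 0 ≤ q.2.2 ∧ q.2.2 ≤ 1}}
      = (Set.Icc (0 : ℝ) 1).indicator (fun z => (Set.Icc (ℓ * z) (u * z)).indicator
          (fun x => ENNReal.ofReal (g z x)) x) z := fun z x => by
    by_cases hz : z ∈ Set.Icc (0 : ℝ) 1
    · by_cases hx : x ∈ Set.Icc (ℓ * z) (u * z)
      · rw [Set.indicator_of_mem hz, Set.indicator_of_mem hx, ← Real.volume_Icc]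
        congr 1
        ext y
        simp_all
      · rw [Set.indicator_of_mem hz, Set.indicator_of_notMem hx]
        convert measure_empty (μ := (volume : Measure ℝ))
        ext y
        simp only [Set.mem_Icc] at hx
        simp only [Set.mem_ofPred_eq, Set.mem_empty_iff_false]
        tauto
    · rw [Set.indicator_of_notMem hz]
      convert measure_empty (μ := (volume : Measure ℝ))
      ext y
      simp only [Set.mem_Icc] at hz
      simp only [Set.mem_ofPred_eq, Set.mem_empty_iff_false]
      tauto
  have hslice : ∀ z, ∫⁻ x, (Set.Icc (0 : ℝ) 1).indicator (fun z => (Set.Icc (ℓ * z) (u * z)).indicator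
      (fun x => ENNReal.ofReal (g z x)) x) z
      = (Set.Icc (0 : ℝ) 1).indicator
        (fun z => ENNReal.ofReal (F z (u * z) - F z (ℓ * z))) z := fun z => by
    by_cases hz : z ∈ Set.Icc (0 : ℝ) 1
    · simp only [Set.indicator_of_mem hz]
      rw [lintegral_indicator measurableSet_Icc,
        lintegral_Icc_ofReal_of_hasDerivAt (hcz z hz.1) (hF z) (hg z) (hg0 z hz)]
    · simp [Set.indicator_of_notMem hz]
  rw [volume_eq_lintegral_lintegral_section hmeas]
  simp only [hinner, hslice]
  rw [lintegral_indicator measurableSet_Icc,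
    lintegral_Icc_ofReal_of_hasDerivAt zero_le_one hH (by fun_prop) fun z hz =>
      sub_nonneg_of_hasDerivAt_nonneg (hcz z hz.1) (hF z) (hg z) (hg0 z hz)]
  congr 1
  simp only [H, mul_one, mul_zero, Real.exp_zero]
  ring

theorem naive_volume_exponential (b ℓ u : ℝ) (hb : 1 < b)
    (hℓ : 0 < ℓ) (hℓu : ℓ < u) (f : ℝ → ℝ)
    (hf : ∀ x : ℝ, f x = b ^ x - 1) :
    volume {q : ℝ × ℝ × ℝ | f q.1 ≤ q.2.1 ∧
        q.2.1 ≤ (f ℓ - (f u - f ℓ) / (u - ℓ) * ℓ) * q.2.2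
                  + (f u - f ℓ) / (u - ℓ) * q.1 ∧
        ℓ * q.2.2 ≤ q.1 ∧ q.1 ≤ u * q.2.2 ∧ 0 ≤ q.2.2 ∧ q.2.2 ≤ 1}
    = ENNReal.ofReal
        ((1/6) * (u - ℓ) * (b ^ u + b ^ ℓ + 1)
          - (1 / (Real.log b) ^ 2) * ((b ^ u - 1) / u - (b ^ ℓ - 1) / ℓ)) := by
  have hk : 0 < Real.log b := Real.log_pos hb
  have hb' : ∀ x : ℝ, b ^ x = Real.exp (Real.log b * x) := Real.rpow_def_of_pos (by linarith)
  have hfe : ∀ x, f x = Real.exp (Real.log b * x) - 1 := fun x => by rw [hf, hb']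
  have hconv : ConvexOn ℝ Set.univ f := by
    have h := (convexOn_exp.comp_linearMap (LinearMap.mul ℝ ℝ (Real.log b))).add_const (-1)
    rw [Set.preimage_univ] at h
    refine h.congr fun x _ => ?_
    simp [hfe, sub_eq_add_neg]
  have hmain := volume_exp_le_linear_cone (α := f ℓ - (f u - f ℓ) / (u - ℓ) * ℓ)
    (m := (f u - f ℓ) / (u - ℓ)) hk hℓ hℓu fun x z hz0 hz1 h1 h2 =>
      hfe x ▸ hconv.le_secant_perspective (by simp [hfe]) hℓu hz0 hz1 h1 h2
  simp only [← hfe] at hmain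
  rw [hmain]
  congr 1
  simp only [hf]
  have hd : u - ℓ ≠ 0 := (sub_pos.2 hℓu).ne'
  have hu : u ≠ 0 := (hℓ.trans hℓu).ne'
  field_simp
  ring
end

section
/- Let 0 < ℓ < u and let f : ℝ → ℝ be positive, continuous, and convex on [ℓ,u]. Suppose a ∈ [ℓ,u] satisfies f(a) ≤ a · ∂₊f(x) for all x ∈ [a,u), where ∂₊f(x) denotes the right derivative of f at x. Define g : [0,u] → ℝ by g(x) := (f(a)/a)·x for 0 ≤ x ≤ a and g(x) := f(x) for a < x ≤ u. Then g is convex on [0,u] and strictly increasing on [0,u]. -/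
/-- The tightened function `g`: linear through the origin on `[0,a]`,
equal to `f` beyond `a`. -/
noncomputable def tightened (f : ℝ → ℝ) (a : ℝ) : ℝ → ℝ :=
  fun x => if x ≤ a then f a / a * x else f x

theorem tightened_of_le {f : ℝ → ℝ} {a x : ℝ} (hx : x ≤ a) :
    tightened f a x = f a / a * x := if_pos hx

theorem tightened_of_ge {f : ℝ → ℝ} {a x : ℝ} (ha : a ≠ 0) (hx : a ≤ x) :
    tightened f a x = f x := by
  rcases hx.eq_or_lt with rfl | hx
  · rw [tightened_of_le le_rfl, div_mul_cancel₀ _ ha]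
  · exact if_neg hx.not_ge

/-- If `f` is convex and its right derivative at `x`, in the sense of `derivWithin`, is at least a
positive `m`, then the secants of `f` starting at `x` have slope at least `m`. -/
theorem ConvexOn.mul_sub_le_of_le_derivWithin_Ici {f : ℝ → ℝ} {S : Set ℝ} {m x y : ℝ}
    (hf : ConvexOn ℝ S f) (hx : x ∈ S) (hy : y ∈ S) (hxy : x < y) (hm : 0 < m)
    (h : m ≤ derivWithin f (Set.Ici x) x) : m * (y - x) ≤ f y - f x := by
  have hd : DifferentiableWithinAt ℝ f (Set.Ici x) x :=
    differentiableWithinAt_of_derivWithin_ne_zero (hm.trans_le h).ne'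
  have hs := hf.rightDeriv_le_slope hx hy hxy (hd.mono Set.Ioi_subset_Ici_self)
  rw [derivWithin_Ioi_eq_Ici, slope_def_field] at hs
  exact (le_div_iff₀ (sub_pos.2 hxy)).1 (h.trans hs)

/-- Replacing a convex function `f` on `[a, u]` by the linear function through the origin on
`[0, a]` keeps it convex as soon as `f` lies above the line. -/
theorem convexOn_tightened {f : ℝ → ℝ} {a u : ℝ} (ha : 0 < a)
    (hf : ConvexOn ℝ (Set.Icc a u) f) (hle : ∀ x ∈ Set.Icc a u, f a / a * x ≤ f x) :
    ConvexOn ℝ (Set.Icc 0 u) (tightened f a) := by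
  have hg : ∀ x ∈ Set.Icc 0 u, f a / a * x ≤ tightened f a x := by
    intro x hx
    rcases le_total x a with h | h
    · exact (tightened_of_le h).ge
    · rw [tightened_of_ge ha.ne' h]
      exact hle x ⟨h, hx.2⟩
  refine LinearOrder.convexOn_of_lt (convex_Icc 0 u) fun x hx y hy hxy p q hp hq hpq => ?_
  simp only [smul_eq_mul]
  obtain rfl : p = 1 - q := by linarith
  rcases le_or_gt ((1 - q) * x + q * y) a with hz | hz
  · rw [tightened_of_le hz]
    nlinarith [mul_le_mul_of_nonneg_left (hg x hx) hp.le, mul_le_mul_of_nonneg_left (hg y hy) hq.le]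
  have hay : a < y := by nlinarith
  have hyS : y ∈ Set.Icc a u := ⟨hay.le, hy.2⟩
  rw [tightened_of_ge ha.ne' hz.le, tightened_of_ge ha.ne' hay.le]
  rcases le_total a x with hax | hxa
  · rw [tightened_of_ge ha.ne' hax]
    exact hf.2 ⟨hax, hx.2⟩ hyS hp.le hq.le hpq
  rw [tightened_of_le hxa]
  set z := (1 - q) * x + q * y with hzdef
  have hya : 0 < y - a := sub_pos.2 hay
  obtain ⟨t, ht⟩ : ∃ t, t * (y - a) = z - a := ⟨(z - a) / (y - a), div_mul_cancel₀ _ hya.ne'⟩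
  have ht0 : 0 ≤ t := by
    by_contra! h
    nlinarith
  have htq : t ≤ q := by
    by_contra! h
    nlinarith
  have hc := hf.2 ⟨le_rfl, hay.le.trans hy.2⟩ hyS (by linarith : 0 ≤ 1 - t) ht0 (by ring)
  simp only [smul_eq_mul] at hc
  have hfa : f a = f a / a * a := (div_mul_cancel₀ _ ha.ne').symm
  set m := f a / a
  rw [show (1 - t) * a + t * y = z by linarith] at hc
  calc f z ≤ (1 - t) * (m * a) + t * f y := by rwa [← hfa]
    _ = m * z + t * (f y - m * y) := by linear_combination m * ht
    _ ≤ m * z + q * (f y - m * y) := by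
      gcongr
      exact sub_nonneg.2 (hle y hyS)
    _ = (1 - q) * (m * x) + q * f y := by rw [hzdef]; ring

theorem strictMonoOn_tightened {f : ℝ → ℝ} {a u : ℝ} (ha : 0 < a) (hau : a ≤ u) (hfa : 0 < f a)
    (hf : StrictMonoOn f (Set.Icc a u)) : StrictMonoOn (tightened f a) (Set.Icc 0 u) := by
  rw [← Set.Icc_union_Icc_eq_Icc ha.le hau]
  refine StrictMonoOn.union (c := a) ?_ ?_ (isGreatest_Icc ha.le) (isLeast_Icc hau)
  · intro x hx y hy hxy
    rw [tightened_of_le hx.2, tightened_of_le hy.2]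
    exact mul_lt_mul_of_pos_left hxy (div_pos hfa ha)
  · exact hf.congr fun x hx => (tightened_of_ge ha.ne' hx.1).symm

theorem tightened_convex_strictMono (ℓ u a : ℝ) (f : ℝ → ℝ)
    (hℓ : 0 < ℓ) (hℓu : ℓ < u)
    (hf_pos : ∀ x ∈ Set.Icc ℓ u, 0 < f x)
    (hf_cont : ContinuousOn f (Set.Icc ℓ u))
    (hf_conv : ConvexOn ℝ (Set.Icc ℓ u) f)
    (ha : a ∈ Set.Icc ℓ u)
    (ha_slope : ∀ x ∈ Set.Ico a u, f a ≤ a * derivWithin f (Set.Ici x) x) :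
    ConvexOn ℝ (Set.Icc 0 u) (tightened f a) ∧
      StrictMonoOn (tightened f a) (Set.Icc 0 u) := by
  have ha0 : 0 < a := hℓ.trans_le ha.1
  have hm : 0 < f a / a := div_pos (hf_pos a ha) ha0
  have hf : ConvexOn ℝ (Set.Icc a u) f :=
    hf_conv.subset (Set.Icc_subset_Icc_left ha.1) (convex_Icc a u)
  have hsec : ∀ x ∈ Set.Icc a u, ∀ y ∈ Set.Icc a u, x < y → f a / a * (y - x) ≤ f y - f x :=
    fun x hx y hy hxy => hf.mul_sub_le_of_le_derivWithin_Ici hx hy hxy hm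
      ((div_le_iff₀' ha0).2 (ha_slope x ⟨hx.1, hxy.trans_le hy.2⟩))
  refine ⟨convexOn_tightened ha0 hf fun x hx => ?_,
    strictMonoOn_tightened ha0 ha.2 (hf_pos a ha) fun x hx y hy hxy => ?_⟩
  · have hfa : f a / a * a = f a := div_mul_cancel₀ _ ha0.ne'
    rcases hx.1.eq_or_lt with rfl | hax
    · exact hfa.le
    · linarith [hsec a ⟨le_rfl, ha.2⟩ x hx hax]
  · linarith [hsec x hx y hy hxy, mul_pos hm (sub_pos.2 hxy)]
end

section
/- Let p > 1 and 0 < ℓ < u, let f(x) := x^p, and let g(x) := ℓ^{p−1}·x for 0 ≤ x ≤ ℓ and g(x) := x^p for ℓ < x ≤ u. For a function h : ℝ → ℝ write invbreve S⁰_h(ℓ,u) := {(x,y,z) ∈ ℝ³ : h(x) ≤ y ≤ L(x,z), ℓ·z ≤ x ≤ u·z, 0 ≤ z ≤ 1} with L(x,z) := (ℓ^p − ((u^p−ℓ^p)/(u−ℓ))·ℓ)·z + ((u^p−ℓ^p)/(u−ℓ))·x, and let invbreve S*_f(ℓ,u) be the convex hull of {(0,0,0)} ∪ {(x,y,1) :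 ℓ ≤ x ≤ u, x^p ≤ y ≤ ℓ^p + ((u^p−ℓ^p)/(u−ℓ))·(x−ℓ)}. Then, writing vol for 3-dimensional Lebesgue volume, (vol(invbreve S⁰_f(ℓ,u)) − vol(invbreve S⁰_g(ℓ,u))) / (vol(invbreve S⁰_f(ℓ,u)) − vol(invbreve S*_f(ℓ,u))) = (p+1)·(1 − ℓ/u) / ((u/ℓ)^{p+1} − 1). -/
open MeasureTheory

/-- `invbreve S⁰_h(ℓ,u)` with the secant upper bound built from `x ↦ x^p`. -/
noncomputable def naivePowSet (h : ℝ → ℝ) (ℓ u p : ℝ) : Set (ℝ × ℝ × ℝ) :=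
  {q | h q.1 ≤ q.2.1 ∧
       q.2.1 ≤ (ℓ ^ p - (u ^ p - ℓ ^ p) / (u - ℓ) * ℓ) * q.2.2
                 + (u ^ p - ℓ ^ p) / (u - ℓ) * q.1 ∧
       ℓ * q.2.2 ≤ q.1 ∧ q.1 ≤ u * q.2.2 ∧ 0 ≤ q.2.2 ∧ q.2.2 ≤ 1}

/-- `invbreve S*_f(ℓ,u)` for `f(x) = x^p`. -/
noncomputable def perspPowSet (ℓ u p : ℝ) : Set (ℝ × ℝ × ℝ) :=
  convexHull ℝ
    ({((0:ℝ), (0:ℝ), (0:ℝ))} ∪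
      {q : ℝ × ℝ × ℝ | q.2.2 = 1 ∧ ℓ ≤ q.1 ∧ q.1 ≤ u ∧
        q.1 ^ p ≤ q.2.1 ∧
        q.2.1 ≤ ℓ ^ p + (u ^ p - ℓ ^ p) / (u - ℓ) * (q.1 - ℓ)})

/-- The points over `T` whose second coordinate lies between `H` and `L`. -/
def slabOver (T : Set (ℝ × ℝ)) (H L : ℝ × ℝ → ℝ) : Set (ℝ × ℝ × ℝ) :=
  {q | (q.1, q.2.2) ∈ T ∧ H (q.1, q.2.2) ≤ q.2.1 ∧ q.2.1 ≤ L (q.1, q.2.2)}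

theorem volume_slabOver_toReal {T : Set (ℝ × ℝ)} {H L : ℝ × ℝ → ℝ} (hT : MeasurableSet T)
    (hH : Measurable H) (hL : Measurable L) (iH : IntegrableOn H T) (iL : IntegrableOn L T)
    (hHL : ∀ q ∈ T, H q ≤ L q) :
    (volume (slabOver T H L)).toReal = ∫ q in T, (L q - H q) := by
  have hS : MeasurableSet (slabOver T H L) := by
    have hπ : Measurable (fun q : ℝ × ℝ × ℝ => (q.1, q.2.2)) := by fun_prop
    have hy : Measurable (fun q : ℝ × ℝ × ℝ => q.2.1) := by fun_prop
    exact (hπ hT).inter ((measurableSet_le (hH.comp hπ) hy).inter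
      (measurableSet_le hy (hL.comp hπ)))
  have hswap : MeasurePreserving (Prod.map id Prod.swap : ℝ × ℝ × ℝ → ℝ × ℝ × ℝ)
      volume volume :=
    (MeasurePreserving.id volume).prod Measure.measurePreserving_swap
  have he := hswap.comp (volume_preserving_prodAssoc (α₁ := ℝ) (β₁ := ℝ) (γ₁ := ℝ))
  rw [← he.measure_preimage hS.nullMeasurableSet, Measure.volume_eq_prod,
    Measure.prod_apply (he.measurable hS),
    integral_eq_lintegral_of_nonneg_ae
      ((ae_restrict_iff' hT).2 (.of_forall fun q hq => sub_nonneg.2 (hHL q hq)))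
      (iL.sub iH).aestronglyMeasurable,
    ← lintegral_indicator hT]
  congr 2 with q
  by_cases hq : q ∈ T
  · rw [Set.indicator_of_mem hq, ← Real.volume_Icc]
    congr 1 with y
    simp [slabOver, hq, MeasurableEquiv.prodAssoc]
  · rw [Set.indicator_of_notMem hq]
    convert measure_empty (μ := (volume : Measure ℝ)) using 2
    ext y
    simp [slabOver, hq, MeasurableEquiv.prodAssoc]

/-- The planar region between the graphs of `lo` and `hi` over `[a, b]`. -/
def closedRegion (a b : ℝ) (lo hi : ℝ → ℝ) : Set (ℝ × ℝ) :=
  {q | q.1 ∈ Set.Icc a b ∧ q.2 ∈ Set.Icc (lo q.1) (hi q.1)}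

theorem setIntegral_closedRegion {a b : ℝ} {lo hi : ℝ → ℝ} {φ : ℝ × ℝ → ℝ} (hab : a ≤ b)
    (hlo : Measurable lo) (hhi : Measurable hi) (hle : ∀ s ∈ Set.Icc a b, lo s ≤ hi s)
    (hφ : IntegrableOn φ (closedRegion a b lo hi)) :
    ∫ q in closedRegion a b lo hi, φ q = ∫ s in a..b, ∫ t in lo s..hi s, φ (s, t) := by
  have hR : MeasurableSet (closedRegion a b lo hi) :=
    (measurable_fst measurableSet_Icc).inter
      ((measurableSet_le (hlo.comp measurable_fst) measurable_snd).inter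
        (measurableSet_le measurable_snd (hhi.comp measurable_fst)))
  rw [← integral_indicator hR, Measure.volume_eq_prod,
    integral_prod _ ((integrable_indicator_iff hR).2 hφ),
    intervalIntegral.integral_of_le hab, ← integral_Icc_eq_integral_Ioc,
    ← integral_indicator measurableSet_Icc]
  congr 1 with s
  by_cases hs : s ∈ Set.Icc a b
  · rw [Set.indicator_of_mem hs, intervalIntegral.integral_of_le (hle s hs),
      ← integral_Icc_eq_integral_Ioc, ← integral_indicator measurableSet_Icc]
    congr 1 with t
    simp only [Set.indicator, closedRegion, Set.mem_ofPred_eq, hs, true_and]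
  · rw [Set.indicator_of_notMem hs]
    have : ∀ t, (s, t) ∉ closedRegion a b lo hi := fun t h => hs h.1
    simp [this]

/-- The triangle of points `(x, z)` with `ℓ z ≤ x ≤ u z` and `0 ≤ z ≤ 1`. -/
def wedge (ℓ u : ℝ) : Set (ℝ × ℝ) :=
  {q | ℓ * q.2 ≤ q.1 ∧ q.1 ≤ u * q.2 ∧ 0 ≤ q.2 ∧ q.2 ≤ 1}

theorem measurableSet_wedge (ℓ u : ℝ) : MeasurableSet (wedge ℓ u) := by
  have hx : Measurable (Prod.fst : ℝ × ℝ → ℝ) := measurable_fst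
  have hz : Measurable (Prod.snd : ℝ × ℝ → ℝ) := measurable_snd
  exact (measurableSet_le (hz.const_mul ℓ) hx).inter
    ((measurableSet_le hx (hz.const_mul u)).inter
      ((measurableSet_le measurable_const hz).inter (measurableSet_le hz measurable_const)))

theorem Continuous.integrableOn_wedge {ℓ u : ℝ} (hℓ : 0 ≤ ℓ) (hu : 0 ≤ u) {φ : ℝ × ℝ → ℝ}
    (hφ : Continuous φ) : IntegrableOn φ (wedge ℓ u) := by
  refine (hφ.integrableOn_Icc (a := ((0 : ℝ), (0 : ℝ))) (b := (u, 1))).mono_set ?_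
  rintro ⟨x, z⟩ ⟨h1, h2, h3, h4⟩
  simp only [Set.mem_Icc, Prod.mk_le_mk] at *
  exact ⟨⟨(mul_nonneg hℓ h3).trans h1, h3⟩, h2.trans (by nlinarith), h4⟩

theorem integrableOn_wedge_of_le {ℓ u : ℝ} (hℓ : 0 ≤ ℓ) (hu : 0 ≤ u) {H L : ℝ × ℝ → ℝ}
    (hH : Measurable H) (hL : Continuous L) (h0 : ∀ q ∈ wedge ℓ u, 0 ≤ H q)
    (hHL : ∀ q ∈ wedge ℓ u, H q ≤ L q) : IntegrableOn H (wedge ℓ u) := by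
  refine Integrable.mono' (hL.integrableOn_wedge hℓ hu) hH.aestronglyMeasurable ?_
  refine (ae_restrict_iff' (measurableSet_wedge ℓ u)).2 (.of_forall fun q hq => ?_)
  rw [Real.norm_of_nonneg (h0 q hq)]
  exact hHL q hq

theorem volume_slabOver_wedge_sub {ℓ u : ℝ} (hℓ : 0 ≤ ℓ) (hu : 0 ≤ u) {F H L : ℝ × ℝ → ℝ}
    (hF : Measurable F) (hH : Measurable H) (hL : Continuous L)
    (h0 : ∀ q ∈ wedge ℓ u, 0 ≤ F q) (hFH : ∀ q ∈ wedge ℓ u, F q ≤ H q)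
    (hHL : ∀ q ∈ wedge ℓ u, H q ≤ L q) :
    IntegrableOn (fun q => H q - F q) (wedge ℓ u) ∧
    (volume (slabOver (wedge ℓ u) F L)).toReal - (volume (slabOver (wedge ℓ u) H L)).toReal
      = ∫ q in wedge ℓ u, (H q - F q) := by
  have hT := measurableSet_wedge ℓ u
  have hFL := fun q hq => (hFH q hq).trans (hHL q hq)
  have iL := hL.integrableOn_wedge hℓ hu
  have iF := integrableOn_wedge_of_le hℓ hu hF hL h0 hFL
  have iH := integrableOn_wedge_of_le hℓ hu hH hL (fun q hq => (h0 q hq).trans (hFH q hq)) hHL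
  refine ⟨iH.sub iF, ?_⟩
  rw [volume_slabOver_toReal hT hF hL.measurable iF iL hFL,
    volume_slabOver_toReal hT hH hL.measurable iH iL hHL,
    integral_sub iL iF, integral_sub iL iH, integral_sub iH iF]
  ring

/-- The perspective `z (x / z) ^ p` of the power function. -/
noncomputable def perspPow (p : ℝ) (q : ℝ × ℝ) : ℝ := q.2 ^ (1 - p) * q.1 ^ p

theorem perspPow_mul {p z w : ℝ} (hp : p ≠ 0) (hz : 0 ≤ z) (hw : 0 ≤ w) :
    perspPow p (z * w, z) = z * w ^ p := by
  rcases hz.eq_or_lt with rfl | hz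
  · simp [perspPow, hp]
  · rw [perspPow, Real.mul_rpow hz.le hw, ← mul_assoc, ← Real.rpow_add hz]
    simp

/-- The secant slope of `x ↦ x ^ p` on `[ℓ, u]`. -/
noncomputable def powSlope (ℓ u p : ℝ) : ℝ := (u ^ p - ℓ ^ p) / (u - ℓ)

/-- The perspective of the secant of `x ↦ x ^ p` on `[ℓ, u]`. -/
noncomputable def powSecant (ℓ u p : ℝ) (q : ℝ × ℝ) : ℝ :=
  (ℓ ^ p - powSlope ℓ u p * ℓ) * q.2 + powSlope ℓ u p * q.1

theorem rpow_le_secant {ℓ u p w : ℝ} (hℓ : 0 ≤ ℓ) (hℓu : ℓ < u) (hp : 1 ≤ p)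
    (h1 : ℓ ≤ w) (h2 : w ≤ u) : w ^ p ≤ ℓ ^ p + powSlope ℓ u p * (w - ℓ) := by
  have hd : 0 < u - ℓ := sub_pos.2 hℓu
  have h := (convexOn_rpow hp).2 (Set.mem_Ici.2 hℓ) (Set.mem_Ici.2 (hℓ.trans hℓu.le))
    (div_nonneg (sub_nonneg.2 h2) hd.le) (div_nonneg (sub_nonneg.2 h1) hd.le)
    (by field_simp; ring)
  simp only [smul_eq_mul] at h
  have hw : (u - w) / (u - ℓ) * ℓ + (w - ℓ) / (u - ℓ) * u = w := by field_simp; ring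
  rw [hw] at h
  refine h.trans_eq ?_
  rw [powSlope]
  field_simp
  ring

theorem exists_of_mem_wedge {ℓ u : ℝ} (hℓu : ℓ ≤ u) {q : ℝ × ℝ} (hq : q ∈ wedge ℓ u) :
    ∃ w ∈ Set.Icc ℓ u, q = (q.2 * w, q.2) := by
  obtain ⟨x, z⟩ := q
  obtain ⟨h1, h2, h3, h4⟩ := hq
  simp only at h1 h2 h3 h4
  rcases h3.eq_or_lt with rfl | hz
  · refine ⟨ℓ, ⟨le_rfl, hℓu⟩, ?_⟩
    simp only [Prod.mk.injEq, zero_mul, and_true]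
    linarith
  · refine ⟨x / z, ⟨(le_div_iff₀ hz).2 h1, (div_le_iff₀ hz).2 h2⟩, ?_⟩
    simp only [Prod.mk.injEq, and_true]
    field_simp

theorem perspPow_le_powSecant {ℓ u p : ℝ} (hℓ : 0 < ℓ) (hℓu : ℓ < u) (hp : 1 < p)
    {q : ℝ × ℝ} (hq : q ∈ wedge ℓ u) : perspPow p q ≤ powSecant ℓ u p q := by
  obtain ⟨w, hw, h⟩ := exists_of_mem_wedge hℓu.le hq
  rw [h, perspPow_mul (by linarith) hq.2.2.1 (hℓ.le.trans hw.1), powSecant]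
  have := mul_le_mul_of_nonneg_left (rpow_le_secant hℓ.le hℓu hp.le hw.1 hw.2) hq.2.2.1
  simp only
  linarith

/-- `x ^ p` with its part over `[0, ℓ]` replaced by the chord through the origin. -/
noncomputable def tightPow (ℓ p x : ℝ) : ℝ := if x ≤ ℓ then ℓ ^ (p - 1) * x else x ^ p

theorem rpow_le_tightPow {ℓ p x : ℝ} (hp : 1 ≤ p) (hx : 0 ≤ x) :
    x ^ p ≤ tightPow ℓ p x := by
  rw [tightPow]
  split_ifs with h
  · rcases hx.eq_or_lt with rfl | hx'
    · rw [Real.zero_rpow (by linarith)]; simp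
    · calc x ^ p = x ^ (p - 1) * x := by
            rw [← Real.rpow_add_one hx'.ne']; simp
        _ ≤ _ := by gcongr
  · exact le_rfl

theorem rpow_le_perspPow {ℓ u p : ℝ} (hℓ : 0 < ℓ) (hℓu : ℓ < u) (hp : 1 < p)
    {q : ℝ × ℝ} (hq : q ∈ wedge ℓ u) : q.1 ^ p ≤ perspPow p q := by
  obtain ⟨w, hw, h⟩ := exists_of_mem_wedge hℓu.le hq
  have hw0 := hℓ.le.trans hw.1
  rw [h, perspPow_mul (by linarith) hq.2.2.1 hw0, Real.mul_rpow hq.2.2.1 hw0]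
  gcongr
  exact Real.rpow_le_self_of_le_one hq.2.2.1 hq.2.2.2 hp.le

theorem tightPow_le_perspPow {ℓ u p : ℝ} (hℓ : 0 < ℓ) (hℓu : ℓ < u) (hp : 1 < p)
    {q : ℝ × ℝ} (hq : q ∈ wedge ℓ u) : tightPow ℓ p q.1 ≤ perspPow p q := by
  rw [tightPow]
  split_ifs
  · obtain ⟨w, hw, h⟩ := exists_of_mem_wedge hℓu.le hq
    have hw0 := hℓ.trans_le hw.1
    rw [h, perspPow_mul (by linarith) hq.2.2.1 hw0.le]
    have hz := hq.2.2.1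
    calc ℓ ^ (p - 1) * (q.2 * w) ≤ w ^ (p - 1) * (q.2 * w) := by
          have := hw.1
          gcongr
      _ = q.2 * w ^ p := by
          rw [mul_left_comm, ← Real.rpow_add_one hw0.ne']; simp
  · exact rpow_le_perspPow hℓ hℓu hp hq

theorem measurable_tightPow (ℓ p : ℝ) : Measurable (tightPow ℓ p) :=
  Measurable.ite measurableSet_Iic (by fun_prop) (by fun_prop)

theorem measurable_perspPow (p : ℝ) : Measurable (perspPow p) := by
  unfold perspPow
  fun_prop

theorem continuous_powSecant (ℓ u p : ℝ) : Continuous (powSecant ℓ u p) := by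
  unfold powSecant
  fun_prop

theorem naivePowSet_eq_slabOver (h : ℝ → ℝ) (ℓ u p : ℝ) :
    naivePowSet h ℓ u p = slabOver (wedge ℓ u) (fun q => h q.1) (powSecant ℓ u p) := by
  ext q
  simp only [naivePowSet, slabOver, wedge, powSecant, powSlope, Set.mem_ofPred_eq]
  tauto

theorem perspPowSet_eq_slabOver {ℓ u p : ℝ} (hℓ : 0 < ℓ) (hℓu : ℓ < u) (hp : 1 < p) :
    perspPowSet ℓ u p = slabOver (wedge ℓ u) (perspPow p) (powSecant ℓ u p) := by
  set C : Set (ℝ × ℝ × ℝ) := {q | q.2.2 = 1 ∧ ℓ ≤ q.1 ∧ q.1 ≤ u ∧ q.1 ^ p ≤ q.2.1 ∧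
    q.2.1 ≤ ℓ ^ p + powSlope ℓ u p * (q.1 - ℓ)} with hC
  have hconv : Convex ℝ C := by
    rintro ⟨x, y, z⟩ ⟨h1, h2, h3, h4, h5⟩ ⟨x', y', z'⟩ ⟨h1', h2', h3', h4', h5'⟩ a b ha hb hab
    have hx := (convexOn_rpow hp.le).2 (Set.mem_Ici.2 (hℓ.le.trans h2))
      (Set.mem_Ici.2 (hℓ.le.trans h2')) ha hb hab
    simp only [hC, Set.mem_ofPred_eq, Prod.smul_mk, Prod.mk_add_mk, smul_eq_mul] at *
    obtain rfl : b = 1 - a := by linarith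
    refine ⟨by rw [h1, h1']; ring, ?_, ?_, hx.trans ?_, ?_⟩
    · nlinarith
    · nlinarith
    · gcongr
    · nlinarith [mul_le_mul_of_nonneg_left h5 ha, mul_le_mul_of_nonneg_left h5' hb]
  have hne : C.Nonempty :=
    ⟨(ℓ, ℓ ^ p, 1), rfl, le_rfl, hℓu.le, le_rfl, by simp⟩
  have hset : perspPowSet ℓ u p = convexHull ℝ (insert ((0 : ℝ), (0 : ℝ), (0 : ℝ)) C) := rfl
  rw [hset, convexHull_insert hne, hconv.convexHull_eq]
  have hp0 : p ≠ 0 := by linarith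
  ext ⟨x, y, z⟩
  simp only [convexJoin_singleton_left, Set.mem_iUnion, exists_prop]
  constructor
  · rintro ⟨⟨w, v, o⟩, ⟨h1, h2, h3, h4, h5⟩, a, t, ha, ht, hat, hq⟩
    simp only at h1 h2 h3 h4 h5
    subst h1
    simp only [Prod.smul_mk, smul_eq_mul, Prod.mk_add_mk, Prod.mk.injEq, mul_zero, zero_add,
      mul_one] at hq
    obtain ⟨rfl, rfl, rfl⟩ := hq
    refine ⟨⟨?_, ?_, ht, by linarith⟩, ?_, ?_⟩
    · simp only; nlinarith
    · simp only; nlinarith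
    · simp only; rw [perspPow_mul hp0 ht (hℓ.le.trans h2)]; gcongr
    · simp only [powSecant]; nlinarith [mul_le_mul_of_nonneg_left h5 ht]
  · rintro ⟨hT, h1, h2⟩
    obtain ⟨w, hw, h⟩ := exists_of_mem_wedge hℓu.le hT
    obtain ⟨-, -, hz0, hz1⟩ := hT
    simp only [Prod.mk.injEq, and_true] at h h1 h2 hz0 hz1
    subst h
    rw [perspPow_mul hp0 hz0 (hℓ.le.trans hw.1)] at h1
    simp only [powSecant] at h2
    rcases hz0.eq_or_lt with rfl | hz
    · obtain ⟨c, hc⟩ := hne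
      refine ⟨c, hc, ?_⟩
      obtain rfl : y = 0 := by apply le_antisymm <;> linarith
      rw [zero_mul]
      exact left_mem_segment _ _ _
    · refine ⟨(w, y / z, 1), ⟨rfl, hw.1, hw.2, ?_, ?_⟩, 1 - z, z, by linarith, hz.le, by ring, ?_⟩
      · simp only; rw [le_div_iff₀ hz]; linarith
      · simp only; rw [div_le_iff₀ hz]; linarith
      · simp; field_simp

theorem setIntegral_wedge_perspPow_sub {ℓ u p : ℝ} (hℓ : 0 < ℓ) (hℓu : ℓ < u) (hp : 1 < p)
    (hi : IntegrableOn (fun q : ℝ × ℝ => perspPow p q - q.1 ^ p) (wedge ℓ u)) :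
    ∫ q in wedge ℓ u, (perspPow p q - q.1 ^ p)
      = (u ^ (p + 1) - ℓ ^ (p + 1)) / (p + 1) * (1 / 3 - 1 / (p + 2)) := by
  have hpre : wedge ℓ u
      = Prod.swap ⁻¹' closedRegion 0 1 (fun z => ℓ * z) (fun z => u * z) := by
    ext q
    simp only [wedge, closedRegion, Set.mem_ofPred_eq, Set.mem_preimage, Set.mem_Icc, Prod.fst_swap,
      Prod.snd_swap]
    tauto
  have hsw : MeasurePreserving (Prod.swap : ℝ × ℝ → ℝ × ℝ) volume volume :=
    Measure.measurePreserving_swap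
  have hemb : MeasurableEmbedding (Prod.swap : ℝ × ℝ → ℝ × ℝ) :=
    MeasurableEquiv.prodComm.measurableEmbedding
  have key := hsw.setIntegral_preimage_emb hemb
    (fun q : ℝ × ℝ => perspPow p q.swap - q.2 ^ p)
    (closedRegion 0 1 (fun z => ℓ * z) (fun z => u * z))
  rw [hpre] at hi ⊢
  refine key.trans ?_
  rw [setIntegral_closedRegion zero_le_one (by fun_prop) (by fun_prop)
    (fun s hs => mul_le_mul_of_nonneg_right hℓu.le hs.1)
    ((hsw.integrableOn_comp_preimage hemb
      (f := fun q : ℝ × ℝ => perspPow p q.swap - q.2 ^ p)).1 hi)]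
  have hinner : ∀ z ∈ Set.uIcc (0 : ℝ) 1,
      ∫ x in ℓ * z..u * z, (perspPow p (Prod.swap (z, x)) - x ^ p)
        = (u ^ (p + 1) - ℓ ^ (p + 1)) / (p + 1) * (z ^ (2 : ℝ) - z ^ (p + 1)) := by
    intro z hz
    rw [Set.uIcc_of_le zero_le_one] at hz
    have h : ∀ x, perspPow p (Prod.swap (z, x)) - x ^ p = (z ^ (1 - p) - 1) * x ^ p := by
      intro x; simp only [perspPow, Prod.swap_prod_mk]; ring
    simp_rw [h]
    rw [intervalIntegral.integral_const_mul, integral_rpow (Or.inl (by linarith)),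
      Real.mul_rpow (by linarith) hz.1, Real.mul_rpow hℓ.le hz.1]
    rcases hz.1.eq_or_lt with rfl | hz0
    · simp [Real.zero_rpow (show p + 1 ≠ 0 by linarith)]
    · have : z ^ (2 : ℝ) = z ^ (1 - p) * z ^ (p + 1) := by
        rw [← Real.rpow_add hz0]; congr 1; ring
      rw [this]; ring
  rw [intervalIntegral.integral_congr hinner, intervalIntegral.integral_const_mul,
    intervalIntegral.integral_sub
      (intervalIntegral.intervalIntegrable_rpow' (by norm_num))
      (intervalIntegral.intervalIntegrable_rpow' (by linarith)),
    integral_rpow (Or.inl (by norm_num)), integral_rpow (Or.inl (by linarith)),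
    Real.zero_rpow (show p + 1 + 1 ≠ 0 by linarith), Real.zero_rpow (by norm_num)]
  simp only [Real.one_rpow, sub_zero]
  congr 2 <;> norm_num
  ring

theorem setIntegral_wedge_tightPow_sub {ℓ u p : ℝ} (hℓ : 0 < ℓ) (hℓu : ℓ < u) (hp : 1 < p)
    (hi : IntegrableOn (fun q : ℝ × ℝ => tightPow ℓ p q.1 - q.1 ^ p) (wedge ℓ u)) :
    ∫ q in wedge ℓ u, (tightPow ℓ p q.1 - q.1 ^ p)
      = (1 / ℓ - 1 / u) * ℓ ^ (p + 2) * (1 / 3 - 1 / (p + 2)) := by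
  have hu : 0 < u := hℓ.trans hℓu
  have hsub : closedRegion 0 ℓ (fun x => x / u) (fun x => x / ℓ) ⊆ wedge ℓ u := by
    rintro ⟨x, z⟩ ⟨⟨h1, h2⟩, h3, h4⟩
    simp only at h1 h2 h3 h4
    have h5 := (div_le_iff₀ hu).1 h3
    have h6 := (le_div_iff₀ hℓ).1 h4
    refine ⟨?_, ?_, (div_nonneg h1 hu.le).trans h3, h4.trans ((div_le_one hℓ).2 h2)⟩ <;>
      simp only <;> linarith
  have hcut := setIntegral_eq_of_subset_of_forall_sdiff_eq_zero (μ := volume)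
    (f := fun q : ℝ × ℝ => tightPow ℓ p q.1 - q.1 ^ p) (measurableSet_wedge ℓ u) hsub (by
      rintro ⟨x, z⟩ ⟨⟨h1, h2, h3, h4⟩, hn⟩
      simp only at h1 h2 h3 h4
      have hx : ¬ x ≤ ℓ := fun hx => hn ⟨⟨(mul_nonneg hℓ.le h3).trans h1, hx⟩,
        (div_le_iff₀ hu).2 (by linarith), (le_div_iff₀ hℓ).2 (by linarith)⟩
      simp [tightPow, hx])
  rw [hcut, setIntegral_closedRegion hℓ.le (by fun_prop) (by fun_prop)
    (fun s hs => div_le_div_of_nonneg_left hs.1 hℓ hℓu.le) (hi.mono_set hsub)]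
  have hinner : ∀ x ∈ Set.uIcc 0 ℓ, ∫ z in x / u..x / ℓ, (tightPow ℓ p x - x ^ p)
      = (1 / ℓ - 1 / u) * (ℓ ^ (p - 1) * x ^ (2 : ℝ) - x ^ (p + 1)) := by
    intro x hx
    rw [Set.uIcc_of_le hℓ.le] at hx
    rw [intervalIntegral.integral_const, tightPow, if_pos hx.2, smul_eq_mul, Real.rpow_two,
      Real.rpow_add_one' hx.1 (by linarith)]
    ring
  simp only
  rw [intervalIntegral.integral_congr hinner, intervalIntegral.integral_const_mul,
    intervalIntegral.integral_sub
      ((intervalIntegral.intervalIntegrable_rpow' (by norm_num)).const_mul _)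
      (intervalIntegral.intervalIntegrable_rpow' (by linarith)),
    intervalIntegral.integral_const_mul,
    integral_rpow (Or.inl (by norm_num)), integral_rpow (Or.inl (by linarith)),
    Real.zero_rpow (show p + 1 + 1 ≠ 0 by linarith), Real.zero_rpow (by norm_num)]
  have h1 : ℓ ^ (p + 2) = ℓ ^ (p - 1) * ℓ ^ ((2 : ℝ) + 1) := by
    rw [← Real.rpow_add hℓ]; congr 1; ring
  rw [show p + 1 + 1 = p + 2 by ring, mul_assoc, ← sub_eq_zero]
  have h3 : (2 : ℝ) + 1 = 3 := by norm_num
  rw [h1, h3]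
  ring

theorem tightened_vs_perspective_ratio (ℓ u p : ℝ)
    (hℓ : 0 < ℓ) (hℓu : ℓ < u) (hp : 1 < p) :
    ((volume (naivePowSet (fun x => x ^ p) ℓ u p)).toReal
        - (volume (naivePowSet
            (fun x => if x ≤ ℓ then ℓ ^ (p - 1) * x else x ^ p) ℓ u p)).toReal)
      / ((volume (naivePowSet (fun x => x ^ p) ℓ u p)).toReal
        - (volume (perspPowSet ℓ u p)).toReal)
    = (p + 1) * (1 - ℓ / u) / ((u / ℓ) ^ (p + 1) - 1) := by
  have hu : 0 < u := hℓ.trans hℓu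
  have hx0 : ∀ q ∈ wedge ℓ u, 0 ≤ q.1 := fun q hq => (mul_nonneg hℓ.le hq.2.2.1).trans hq.1
  have hf : Measurable fun q : ℝ × ℝ => q.1 ^ p := by fun_prop
  have hf0 : ∀ q ∈ wedge ℓ u, 0 ≤ q.1 ^ p := fun q hq => Real.rpow_nonneg (hx0 q hq) p
  have hL := continuous_powSecant ℓ u p
  obtain ⟨iA, hA⟩ := volume_slabOver_wedge_sub hℓ.le hu.le hf
    ((measurable_tightPow ℓ p).comp measurable_fst) hL hf0
    (fun q hq => rpow_le_tightPow hp.le (hx0 q hq))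
    (fun q hq => (tightPow_le_perspPow hℓ hℓu hp hq).trans (perspPow_le_powSecant hℓ hℓu hp hq))
  obtain ⟨iB, hB⟩ := volume_slabOver_wedge_sub hℓ.le hu.le hf (measurable_perspPow p) hL hf0
    (fun q hq => rpow_le_perspPow hℓ hℓu hp hq) (fun q hq => perspPow_le_powSecant hℓ hℓu hp hq)
  change ((volume (naivePowSet (fun x => x ^ p) ℓ u p)).toReal
      - (volume (naivePowSet (tightPow ℓ p) ℓ u p)).toReal) / _ = _
  rw [perspPowSet_eq_slabOver hℓ hℓu hp, naivePowSet_eq_slabOver, naivePowSet_eq_slabOver, hB,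
    setIntegral_wedge_perspPow_sub hℓ hℓu hp iB]
  refine (congrArg (· / _) (hA.trans (setIntegral_wedge_tightPow_sub hℓ hℓu hp iA))).trans ?_
  have hk : (1 : ℝ) / 3 - 1 / (p + 2) ≠ 0 := by
    rw [div_sub_div _ _ (by norm_num) (by linarith)]
    exact div_ne_zero (by linarith) (by positivity)
  have hd : 0 < u ^ (p + 1) - ℓ ^ (p + 1) :=
    sub_pos.2 (Real.rpow_lt_rpow hℓ.le hℓu (by linarith))
  have hℓp : 0 < ℓ ^ (p + 1) := Real.rpow_pos_of_pos hℓ _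
  have hp2 : ℓ ^ (p + 2) = ℓ ^ (p + 1) * ℓ := by
    rw [← Real.rpow_add_one hℓ.ne']; congr 1; ring
  have hden : (u / ℓ) ^ (p + 1) - 1 = (u ^ (p + 1) - ℓ ^ (p + 1)) / ℓ ^ (p + 1) := by
    rw [Real.div_rpow hu.le hℓ.le]; field_simp
  have hp1 : p + 1 ≠ 0 := by linarith
  rw [mul_div_mul_right _ _ hk, hden, hp2]
  field_simp
end

section
/- Let p > 1 and φ ∈ (0,1). Then there exists k ∈ (0,1) such that for all real numbers 0 < ℓ < u the following equivalence holds: ℓ/u > k if and only if (p+1)·(1 − ℓ/u) / ((u/ℓ)^{p+1} − 1) > φ. Equivalently, the function k ↦ (p+1)·(1−k)/(k^{−(p+1)} − 1) is strictly increasing on (0,1) and tends to 1 as k → 1⁻. -/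
open Set Filter Topology

lemma one_lt_rpow_neg_of_mem_Ioo {q k : ℝ} (hq : 0 < q) (hk : k ∈ Ioo (0 : ℝ) 1) :
    1 < k ^ (-q) :=
  Real.one_lt_rpow_of_pos_of_lt_one_of_neg hk.1 hk.2 (neg_lt_zero.mpr hq)

lemma strictConvexOn_rpow_neg {q : ℝ} (hq : 0 < q) :
    StrictConvexOn ℝ (Ioi 0) fun x : ℝ => x ^ (-q) := by
  refine StrictMonoOn.strictConvexOn_of_deriv (convex_Ioi 0)
    (fun x hx => (Real.continuousAt_rpow_const x _ (Or.inl (ne_of_gt hx))).continuousWithinAt) ?_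
  rw [interior_Ioi]
  intro x hx y hy hxy
  rw [Real.deriv_rpow_const, Real.deriv_rpow_const]
  have h : y ^ (-q - 1) < x ^ (-q - 1) := Real.rpow_lt_rpow_of_neg hx hxy (by linarith)
  nlinarith

lemma strictMonoOn_mul_one_sub_div_rpow_neg_sub_one {q : ℝ} (hq : 0 < q) :
    StrictMonoOn (fun k : ℝ => q * (1 - k) / (k ^ (-q) - 1)) (Ioo (0 : ℝ) 1) := by
  intro x hx y hy hxy
  have h := (strictConvexOn_rpow_neg hq).secant_strict_mono (a := 1) (x := x) (y := y)
    (mem_Ioi.mpr one_pos) hx.1 hy.1 hx.2.ne hy.2.ne hxy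
  have hX := one_lt_rpow_neg_of_mem_Ioo hq hx
  have hY := one_lt_rpow_neg_of_mem_Ioo hq hy
  have hx1 := sub_pos.mpr hx.2
  have hy1 := sub_pos.mpr hy.2
  simp only [Real.one_rpow] at h
  rw [← neg_sub 1 x, ← neg_sub 1 y, div_neg, div_neg, neg_lt_neg_iff,
    div_lt_div_iff₀ hy1 hx1] at h
  change q * (1 - x) / (x ^ (-q) - 1) < q * (1 - y) / (y ^ (-q) - 1)
  rw [div_lt_div_iff₀ (sub_pos.mpr hX) (sub_pos.mpr hY)]
  nlinarith

lemma tendsto_mul_one_sub_div_rpow_neg_sub_one {q : ℝ} (hq : 0 < q) :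
    Tendsto (fun k : ℝ => q * (1 - k) / (k ^ (-q) - 1)) (𝓝[<] 1) (𝓝 1) := by
  have hd : HasDerivAt (fun x : ℝ => x ^ (-q)) (-q) 1 := by
    simpa using Real.hasDerivAt_rpow_const (x := 1) (p := -q) (Or.inl one_ne_zero)
  have hs := (hasDerivAt_iff_tendsto_slope.mp hd).mono_left
    (nhdsWithin_mono 1 fun x (hx : x < 1) => hx.ne)
  have h := (hs.inv₀ (neg_ne_zero.mpr hq.ne')).const_mul (-q)
  rw [mul_inv_cancel₀ (neg_ne_zero.mpr hq.ne')] at h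
  refine h.congr fun k => ?_
  rw [slope_def_field, Real.one_rpow, inv_div]
  ring

lemma continuousOn_mul_one_sub_div_rpow_neg_sub_one {q : ℝ} (hq : 0 < q) :
    ContinuousOn (fun k : ℝ => q * (1 - k) / (k ^ (-q) - 1)) (Ioo (0 : ℝ) 1) := by
  refine ContinuousOn.div (by fun_prop) (ContinuousOn.sub ?_ continuousOn_const)
    fun k hk => (sub_pos.mpr (one_lt_rpow_neg_of_mem_Ioo hq hk)).ne'
  exact fun k hk => (Real.continuousAt_rpow_const k _ (Or.inl hk.1.ne')).continuousWithinAt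

lemma mul_one_sub_div_rpow_neg_sub_one_le {q k : ℝ} (hq : 1 ≤ q) (hk : k ∈ Ioo (0 : ℝ) 1) :
    q * (1 - k) / (k ^ (-q) - 1) ≤ q * k := by
  have hpos := sub_pos.mpr (one_lt_rpow_neg_of_mem_Ioo (one_pos.trans_le hq) hk)
  have h : k⁻¹ ≤ k ^ (-q) := by
    rw [← Real.rpow_neg_one]
    exact Real.rpow_le_rpow_of_exponent_ge hk.1 hk.2.le (neg_le_neg hq)
  have h1 : 1 ≤ k * k ^ (-q) := (inv_le_iff_one_le_mul₀' hk.1).mp h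
  rw [div_le_iff₀ hpos]
  nlinarith

lemma exists_mul_one_sub_div_rpow_neg_sub_one_eq {q φ : ℝ} (hq : 1 ≤ q)
    (hφ : φ ∈ Ioo (0 : ℝ) 1) :
    ∃ k ∈ Ioo (0 : ℝ) 1, q * (1 - k) / (k ^ (-q) - 1) = φ := by
  have hq0 : 0 < q := one_pos.trans_le hq
  have ha : φ / q ∈ Ioo (0 : ℝ) 1 :=
    ⟨div_pos hφ.1 hq0, (div_lt_one hq0).mpr (hφ.2.trans_le hq)⟩
  have hle := mul_one_sub_div_rpow_neg_sub_one_le hq ha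
  rw [mul_div_cancel₀ _ hq0.ne'] at hle
  obtain ⟨b, hb, hab⟩ := (((tendsto_mul_one_sub_div_rpow_neg_sub_one hq0).eventually
    (lt_mem_nhds hφ.2)).and (Ioo_mem_nhdsLT ha.2)).exists
  have hsub : Icc (φ / q) b ⊆ Ioo (0 : ℝ) 1 :=
    fun x hx => ⟨ha.1.trans_le hx.1, hx.2.trans_lt hab.2⟩
  obtain ⟨k, hk, hkφ⟩ := intermediate_value_Icc hab.1.le
    ((continuousOn_mul_one_sub_div_rpow_neg_sub_one hq0).mono hsub) ⟨hle, hb.le⟩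
  exact ⟨k, hsub hk, hkφ⟩

theorem threshold_for_ratio (p φ : ℝ) (hp : 1 < p) (hφ : φ ∈ Set.Ioo (0:ℝ) 1) :
    (∃ k ∈ Set.Ioo (0:ℝ) 1, ∀ ℓ u : ℝ, 0 < ℓ → ℓ < u →
        (k < ℓ / u ↔ φ < (p + 1) * (1 - ℓ / u) / ((u / ℓ) ^ (p + 1) - 1))) ∧
      StrictMonoOn (fun k : ℝ => (p + 1) * (1 - k) / (k ^ (-(p + 1)) - 1))
        (Set.Ioo (0:ℝ) 1) ∧
      Filter.Tendsto (fun k : ℝ => (p + 1) * (1 - k) / (k ^ (-(p + 1)) - 1))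
        (nhdsWithin 1 (Set.Iio 1)) (nhds 1) := by
  have hq : 0 < p + 1 := by linarith
  have hmono := strictMonoOn_mul_one_sub_div_rpow_neg_sub_one hq
  refine ⟨?_, hmono, tendsto_mul_one_sub_div_rpow_neg_sub_one hq⟩
  obtain ⟨k, hk, hkφ⟩ := exists_mul_one_sub_div_rpow_neg_sub_one_eq (q := p + 1) (by linarith) hφ
  refine ⟨k, hk, fun ℓ u hℓ hu => ?_⟩
  have hu0 := hℓ.trans hu
  have hmem : ℓ / u ∈ Ioo (0 : ℝ) 1 := ⟨div_pos hℓ hu0, (div_lt_one hu0).mpr hu⟩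
  have hpow : (u / ℓ) ^ (p + 1) = (ℓ / u) ^ (-(p + 1)) := by
    rw [Real.rpow_neg hmem.1.le, ← Real.inv_rpow hmem.1.le, inv_div]
  rw [hpow, ← hkφ]
  exact (hmono.lt_iff_lt hk hmem).symm
end

section
/- Let 0 < ℓ < u, p > 1 and q ∈ [0, p−1]. Then the set bar S_p^q(ℓ,u) := {(x,y,z) ∈ ℝ³ : y ≥ 0, x^p ≤ y·z^q, y ≤ z·u^p, ℓ·z ≤ x ≤ u·z, 0 ≤ z ≤ 1} is a convex subset of ℝ³. -/
/-- `bar S_p^q(ℓ,u)`; real powers (`Real.rpow`, with `0^0 = 1`). -/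
noncomputable def barSpq (ℓ u p q : ℝ) : Set (ℝ × ℝ × ℝ) :=
  {s | 0 ≤ s.2.1 ∧ s.1 ^ p ≤ s.2.1 * s.2.2 ^ q ∧ s.2.1 ≤ s.2.2 * u ^ p ∧
       ℓ * s.2.2 ≤ s.1 ∧ s.1 ≤ u * s.2.2 ∧ 0 ≤ s.2.2 ∧ s.2.2 ≤ 1}

/-- Weighted AM-GM: the tangent plane at `(1, 1)` bounds `s ^ p / t ^ q` from below. -/
theorem mul_le_of_rpow_le_mul_rpow {p q s w t : ℝ} (hp : 0 < p) (hq : 0 ≤ q) (hqp : q ≤ p - 1)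
    (hs : 0 ≤ s) (hw : 0 ≤ w) (ht : 0 ≤ t) (h : s ^ p ≤ w * t ^ q) :
    p * s ≤ w + q * t + (p - 1 - q) := by
  have hs' : s ≤ w ^ (1 / p) * t ^ (q / p) * 1 ^ ((p - 1 - q) / p) := by
    have h1 := Real.rpow_le_rpow (Real.rpow_nonneg hs p) h (one_div_nonneg.2 hp.le)
    rw [← Real.rpow_mul hs, mul_one_div_cancel hp.ne', Real.rpow_one,
      Real.mul_rpow hw (Real.rpow_nonneg ht q), ← Real.rpow_mul ht, mul_one_div] at h1
    rwa [Real.one_rpow, mul_one]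
  have amgm := Real.geom_mean_le_arith_mean3_weighted (one_div_nonneg.2 hp.le)
    (div_nonneg hq hp.le) (div_nonneg (sub_nonneg.2 hqp) hp.le) hw ht zero_le_one
    (by field_simp; ring)
  calc p * s ≤ p * (1 / p * w + q / p * t + (p - 1 - q) / p * 1) :=
        mul_le_mul_of_nonneg_left (hs'.trans amgm) hp.le
    _ = w + q * t + (p - 1 - q) := by field_simp

/-- The rescaled form of `mul_le_of_rpow_le_mul_rpow`: the tangent plane at `(X, Z)`. -/
theorem mul_div_le_of_rpow_le_mul_rpow {p q x y z X Z : ℝ} (hp : 0 < p) (hq : 0 ≤ q)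
    (hqp : q ≤ p - 1) (hx : 0 ≤ x) (hy : 0 ≤ y) (hz : 0 ≤ z) (hX : 0 < X) (hZ : 0 < Z)
    (h : x ^ p ≤ y * z ^ q) :
    p * (x / X) ≤ y / (X ^ p / Z ^ q) + q * (z / Z) + (p - 1 - q) := by
  have hXp := Real.rpow_pos_of_pos hX p
  have hZq := Real.rpow_pos_of_pos hZ q
  refine mul_le_of_rpow_le_mul_rpow hp hq hqp (by positivity) (by positivity) (by positivity) ?_
  rw [Real.div_rpow hx hX.le, Real.div_rpow hz hZ.le]
  calc x ^ p / X ^ p ≤ y * z ^ q / X ^ p := by gcongr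
    _ = y / (X ^ p / Z ^ q) * (z ^ q / Z ^ q) := by field_simp

theorem barSpq_convex (ℓ u p q : ℝ) (hℓ : 0 < ℓ) (hℓu : ℓ < u)
    (hp : 1 < p) (hq : q ∈ Set.Icc (0:ℝ) (p - 1)) :
    Convex ℝ (barSpq ℓ u p q) := by
  rintro ⟨x₁, y₁, z₁⟩ ⟨hy₁, h₁, hyu₁, hl₁, hu₁, hz₁, hz₁'⟩
    ⟨x₂, y₂, z₂⟩ ⟨hy₂, h₂, hyu₂, hl₂, hu₂, hz₂, hz₂'⟩ a b ha hb hab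
  obtain ⟨hq, hqp⟩ := hq
  simp only at hy₁ h₁ hyu₁ hl₁ hu₁ hz₁ hz₁' hy₂ h₂ hyu₂ hl₂ hu₂ hz₂ hz₂'
  have hp₀ : 0 < p := by linarith
  have hx₁ : 0 ≤ x₁ := (mul_nonneg hℓ.le hz₁).trans hl₁
  have hx₂ : 0 ≤ x₂ := (mul_nonneg hℓ.le hz₂).trans hl₂
  have hY : 0 ≤ a * y₁ + b * y₂ := by positivity
  have hZ : 0 ≤ a * z₁ + b * z₂ := by positivity
  have hXu : a * x₁ + b * x₂ ≤ u * (a * z₁ + b * z₂) := by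
    linarith [mul_le_mul_of_nonneg_left hu₁ ha, mul_le_mul_of_nonneg_left hu₂ hb]
  simp only [barSpq, Set.mem_ofPred_eq, Prod.smul_mk, Prod.mk_add_mk, smul_eq_mul]
  refine ⟨hY, ?_, ?_, ?_, hXu, hZ, ?_⟩
  · rcases (show 0 ≤ a * x₁ + b * x₂ by positivity).eq_or_lt' with hX | hX
    · rw [hX, Real.zero_rpow hp₀.ne']
      exact mul_nonneg hY (Real.rpow_nonneg hZ q)
    · have hZ' : 0 < a * z₁ + b * z₂ :=
        pos_of_mul_pos_right (hX.trans_le hXu) (hℓ.trans hℓu).le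
      have t₁ := mul_le_mul_of_nonneg_left
        (mul_div_le_of_rpow_le_mul_rpow hp₀ hq hqp hx₁ hy₁ hz₁ hX hZ' h₁) ha
      have t₂ := mul_le_mul_of_nonneg_left
        (mul_div_le_of_rpow_le_mul_rpow hp₀ hq hqp hx₂ hy₂ hz₂ hX hZ' h₂) hb
      have hXp := Real.rpow_pos_of_pos hX p
      have hZq := Real.rpow_pos_of_pos hZ' q
      set X := a * x₁ + b * x₂ with hXdef
      set Z := a * z₁ + b * z₂ with hZdef
      have eX : a * (x₁ / X) + b * (x₂ / X) = 1 := by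
        rw [← mul_div_assoc, ← mul_div_assoc, ← add_div, ← hXdef, div_self hX.ne']
      have eZ : a * (z₁ / Z) + b * (z₂ / Z) = 1 := by
        rw [← mul_div_assoc, ← mul_div_assoc, ← add_div, ← hZdef, div_self hZ'.ne']
      have key : 1 ≤ (a * y₁ + b * y₂) / (X ^ p / Z ^ q) := by
        rw [add_div, mul_div_assoc, mul_div_assoc]
        linear_combination t₁ + t₂ - p * eX + q * eZ + (p - 1 - q) * hab
      rwa [one_le_div (by positivity), div_le_iff₀ hZq] at key
  · linarith [mul_le_mul_of_nonneg_left hyu₁ ha, mul_le_mul_of_nonneg_left hyu₂ hb]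
  · linarith [mul_le_mul_of_nonneg_left hl₁ ha, mul_le_mul_of_nonneg_left hl₂ hb]
  · linarith [mul_le_mul_of_nonneg_left hz₁' ha, mul_le_mul_of_nonneg_left hz₂' hb]
end

section
/- Let 0 < ℓ < u and p > 1. Then the convex hull of bar S_p(ℓ,u) := {(x,y,z) ∈ ℝ³ : z ∈ {0,1}, x^p ≤ y, y ≤ z·u^p, ℓ·z ≤ x ≤ u·z} equals bar S_p^{p−1}(ℓ,u) := {(x,y,z) ∈ ℝ³ : y ≥ 0, x^p ≤ y·z^{p−1}, y ≤ z·u^p, ℓ·z ≤ x ≤ u·z, 0 ≤ z ≤ 1}. -/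
/-- `bar S_p(ℓ,u)`, the mixed-integer set with `z ∈ {0,1}`. -/
noncomputable def barSp (ℓ u p : ℝ) : Set (ℝ × ℝ × ℝ) :=
  {s | (s.2.2 = 0 ∨ s.2.2 = 1) ∧ s.1 ^ p ≤ s.2.1 ∧ s.2.1 ≤ s.2.2 * u ^ p ∧
       ℓ * s.2.2 ≤ s.1 ∧ s.1 ≤ u * s.2.2}

/-- The slice of `barSp` at height `z = 1`. -/
def barSpSlice (ℓ u p : ℝ) : Set (ℝ × ℝ × ℝ) :=
  {s | s.2.2 = 1 ∧ s.1 ^ p ≤ s.2.1 ∧ s.2.1 ≤ u ^ p ∧ ℓ ≤ s.1 ∧ s.1 ≤ u}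

theorem barSp_eq_insert {ℓ u p : ℝ} (hp : p ≠ 0) :
    barSp ℓ u p = insert 0 (barSpSlice ℓ u p) := by
  ext ⟨x, y, z⟩
  simp only [barSp, barSpSlice, Set.mem_insert_iff, Set.mem_ofPred_eq, Prod.ext_iff,
    Prod.fst_zero, Prod.snd_zero]
  constructor
  · rintro ⟨rfl | rfl, h1, h2, h3, h4⟩
    · simp only [mul_zero, zero_mul] at h2 h3 h4
      obtain rfl : x = 0 := le_antisymm h4 h3
      rw [Real.zero_rpow hp] at h1
      exact Or.inl ⟨rfl, le_antisymm h2 h1, rfl⟩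
    · simp only [mul_one, one_mul] at h2 h3 h4
      exact Or.inr ⟨rfl, h1, h2, h3, h4⟩
  · rintro (⟨rfl, rfl, rfl⟩ | ⟨rfl, h⟩)
    · simp [Real.zero_rpow hp]
    · simpa using h

theorem convex_barSpSlice {ℓ u p : ℝ} (hℓ : 0 ≤ ℓ) (hp : 1 ≤ p) :
    Convex ℝ (barSpSlice ℓ u p) := by
  rintro ⟨x, y, z⟩ ⟨hz, hxy, hy, hx, hxu⟩ ⟨x', y', z'⟩ ⟨hz', hxy', hy', hx', hxu'⟩ a b ha hb hab
  simp only at hz hxy hy hx hxu hz' hxy' hy' hx' hxu'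
  have hconv := (convexOn_rpow hp).2 (x := x) (hℓ.trans hx) (y := x') (hℓ.trans hx') ha hb hab
  simp only [smul_eq_mul] at hconv
  obtain rfl : b = 1 - a := by linarith
  simp only [barSpSlice, Set.mem_ofPred_eq, Prod.smul_mk, Prod.mk_add_mk, smul_eq_mul]
  refine ⟨by rw [hz, hz']; ring, hconv.trans ?_, ?_, ?_, ?_⟩
  · gcongr
  all_goals nlinarith

theorem convexHull_barSp_eq (ℓ u p : ℝ) (hℓ : 0 < ℓ) (hℓu : ℓ < u) (hp : 1 < p) :
    convexHull ℝ (barSp ℓ u p) = barSpq ℓ u p (p - 1) := by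
  have hp0 : p ≠ 0 := by positivity
  have hu : (u, u ^ p, (1 : ℝ)) ∈ barSpSlice ℓ u p := ⟨rfl, le_rfl, le_rfl, hℓu.le, le_rfl⟩
  have hpow {z : ℝ} (hz : 0 ≤ z) : z ^ p = z * z ^ (p - 1) := by
    rw [← Real.rpow_one_add' hz (by linarith), add_sub_cancel]
  rw [barSp_eq_insert hp0, convexHull_insert ⟨_, hu⟩,
    (convex_barSpSlice hℓ.le hp.le).convexHull_eq]
  ext ⟨x, y, z⟩
  simp only [mem_convexJoin, Set.mem_singleton_iff, exists_eq_left]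
  constructor
  · rintro ⟨⟨x', y', z'⟩, ⟨hz', hxy, hy, hx, hxu⟩, a, b, ha, hb, hab, h⟩
    simp only at hz' hxy hy hx hxu
    simp only [smul_zero, zero_add, Prod.smul_mk, smul_eq_mul, Prod.mk.injEq, hz', mul_one] at h
    obtain ⟨rfl, rfl, rfl⟩ := h
    have hx0 : 0 ≤ x' := hℓ.le.trans hx
    have hy0 : 0 ≤ y' := (Real.rpow_nonneg hx0 p).trans hxy
    refine ⟨mul_nonneg hb hy0, ?_, mul_le_mul_of_nonneg_left hy hb, ?_, ?_, hb, by linarith⟩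
    · calc (b * x') ^ p = b * b ^ (p - 1) * x' ^ p := by rw [Real.mul_rpow hb hx0, hpow hb]
        _ ≤ b * b ^ (p - 1) * y' := by gcongr
        _ = b * y' * b ^ (p - 1) := by ring
    · nlinarith
    · nlinarith
  · rintro ⟨hy0, hxy, hy, hx, hxu, hz0, hz1⟩
    simp only at hy0 hxy hy hx hxu hz0 hz1
    rcases hz0.eq_or_lt with rfl | hz
    · simp only [mul_zero, zero_mul] at hy hx hxu
      obtain rfl : x = 0 := le_antisymm hxu hx
      obtain rfl : y = 0 := le_antisymm hy hy0
      exact ⟨_, hu, left_mem_segment ℝ 0 _⟩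
    · have hx0 : 0 ≤ x := (mul_nonneg hℓ.le hz0).trans hx
      refine ⟨(x / z, y / z, 1), ⟨rfl, ?_, ?_, ?_, ?_⟩, 1 - z, z, by linarith, hz0, by ring, ?_⟩
      · have hzp : 0 < z ^ (p - 1) := Real.rpow_pos_of_pos hz _
        simp only
        rw [Real.div_rpow hx0 hz0, hpow hz0, div_le_div_iff₀ (by positivity) hz]
        nlinarith
      · exact (div_le_iff₀' hz).2 hy
      · exact (le_div_iff₀ hz).2 hx
      · exact (div_le_iff₀ hz).2 hxu
      · simp [mul_div_cancel₀, hz.ne']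
end

section
/- Let 0 < ℓ < u, p > 1 and q ∈ [0, p−1]. Then the 3-dimensional Lebesgue volume of bar S_p^q(ℓ,u) := {(x,y,z) ∈ ℝ³ : y ≥ 0, x^p ≤ y·z^q, y ≤ z·u^p, ℓ·z ≤ x ≤ u·z, 0 ≤ z ≤ 1} equals ((p² − p·q + 3p − q − 1)·u^{p+1} + 3·ℓ^{p+1} − (p+1)·(p−q+2)·ℓ·u^p) / (3·(p+1)·(p−q+2)). -/
open MeasureTheory

/-- A function that agrees with a nonnegative interval integrable `f` on `(a, b]` and vanishes
outside `[a, b]` has as lower Lebesgue integral the interval integral of `f`. -/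
theorem lintegral_eq_ofReal_intervalIntegral {a b : ℝ} (hab : a ≤ b) {f : ℝ → ℝ}
    (hf : IntervalIntegrable f volume a b) (hf₀ : ∀ x ∈ Set.Ioc a b, 0 ≤ f x)
    {g : ℝ → ENNReal} (hg : ∀ x ∈ Set.Ioc a b, g x = ENNReal.ofReal (f x))
    (hg₀ : ∀ x ∉ Set.Icc a b, g x = 0) :
    ∫⁻ x, g x = ENNReal.ofReal (∫ x in a..b, f x) := by
  have hae : g =ᵐ[volume] (Set.Ioc a b).indicator (fun x => ENNReal.ofReal (f x)) := by
    have hne : ∀ᵐ x : ℝ, x ≠ a := by simp [ae_iff, measure_singleton]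
    filter_upwards [hne] with x hx
    by_cases h : x ∈ Set.Ioc a b
    · rw [Set.indicator_of_mem h, hg x h]
    · rw [Set.indicator_of_notMem h]
      exact hg₀ x fun h' => h ⟨lt_of_le_of_ne h'.1 hx.symm, h'.2⟩
  rw [lintegral_congr_ae hae, lintegral_indicator measurableSet_Ioc,
    intervalIntegral.integral_of_le hab, ofReal_integral_eq_lintegral_ofReal]
  · exact (intervalIntegrable_iff_integrableOn_Ioc_of_le hab).1 hf
  · exact (ae_restrict_iff' measurableSet_Ioc).2 (Filter.Eventually.of_forall hf₀)

theorem measurableSet_barSpq (ℓ u p q : ℝ) : MeasurableSet (barSpq ℓ u p q) := by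
  have hle {f g : ℝ × ℝ × ℝ → ℝ} (hf : Measurable f) (hg : Measurable g) :
      MeasurableSet {s | f s ≤ g s} := measurableSet_le hf hg
  unfold barSpq
  simp only [Set.ofPred_and]
  refine (hle ?_ ?_).inter ((hle ?_ ?_).inter ((hle ?_ ?_).inter ((hle ?_ ?_).inter
    ((hle ?_ ?_).inter ((hle ?_ ?_).inter (hle ?_ ?_)))))) <;> fun_prop

/-- The area of a horizontal slice of `barSpq`. -/
theorem volume_barSpq_slice {ℓ u p q z : ℝ} (hℓ : 0 < ℓ) (hℓu : ℓ < u) (hp : 1 < p)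
    (hq : q ≤ p - 1) (hz : z ∈ Set.Ioc (0 : ℝ) 1) :
    volume {w : ℝ × ℝ | (w.1, w.2, z) ∈ barSpq ℓ u p q} = ENNReal.ofReal
      (u ^ p * (u - ℓ) * z ^ 2
        - (u ^ (p + 1) - ℓ ^ (p + 1)) / (p + 1) * z ^ (p - q + 1)) := by
  obtain ⟨hz0, hz1⟩ := hz
  have hu : 0 < u := hℓ.trans hℓu
  have hzq : 0 < z ^ q := Real.rpow_pos_of_pos hz0 q
  have hm : MeasurableSet {w : ℝ × ℝ | (w.1, w.2, z) ∈ barSpq ℓ u p q} :=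
    (measurableSet_barSpq ℓ u p q).preimage (by fun_prop)
  have hab : ℓ * z ≤ u * z := by gcongr
  have hint : IntervalIntegrable (fun x : ℝ => x ^ p) volume (ℓ * z) (u * z) :=
    intervalIntegral.intervalIntegrable_rpow' (by linarith)
  rw [Measure.volume_eq_prod, Measure.prod_apply hm,
    lintegral_eq_ofReal_intervalIntegral (f := fun x => z * u ^ p - x ^ p / z ^ q) hab
      (intervalIntegrable_const.sub (hint.div_const _))]
  · congr 1
    rw [intervalIntegral.integral_sub intervalIntegrable_const (hint.div_const _),
      intervalIntegral.integral_const, intervalIntegral.integral_div,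
      integral_rpow (Or.inl (by linarith)), Real.mul_rpow hu.le hz0.le,
      Real.mul_rpow hℓ.le hz0.le, show p - q + 1 = (p + 1) - q by ring,
      Real.rpow_sub hz0, smul_eq_mul]
    ring
  · rintro x ⟨hx1, hx2⟩
    have hx0 : 0 ≤ x := (mul_pos hℓ hz0).le.trans hx1.le
    rw [sub_nonneg, div_le_iff₀ hzq]
    calc x ^ p ≤ (u * z) ^ p := Real.rpow_le_rpow hx0 hx2 (by linarith)
      _ = u ^ p * z ^ p := Real.mul_rpow hu.le hz0.le
      _ ≤ u ^ p * z ^ (1 + q) := by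
        gcongr u ^ p * ?_
        exact Real.rpow_le_rpow_of_exponent_ge hz0 hz1 (by linarith)
      _ = z * u ^ p * z ^ q := by rw [Real.rpow_add hz0, Real.rpow_one]; ring
  · rintro x ⟨hx1, hx2⟩
    have hx0 : 0 ≤ x := (mul_pos hℓ hz0).le.trans hx1.le
    rw [← Real.volume_Icc]
    congr 1
    ext y
    simp only [barSpq, Set.mem_preimage, Set.mem_ofPred_eq, Set.mem_Icc, div_le_iff₀ hzq]
    refine ⟨fun h => ⟨h.2.1, h.2.2.1⟩, fun h => ⟨?_, h.1, h.2, hx1.le, hx2, hz0.le, hz1⟩⟩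
    exact nonneg_of_mul_nonneg_left ((Real.rpow_nonneg hx0 p).trans h.1) hzq
  · intro x hx
    convert measure_empty (μ := (volume : Measure ℝ))
    ext y
    simp only [barSpq, Set.mem_preimage, Set.mem_ofPred_eq, Set.mem_empty_iff_false, iff_false]
    exact fun h => hx ⟨h.2.2.2.1, h.2.2.2.2.1⟩

theorem barSpq_volume (ℓ u p q : ℝ) (hℓ : 0 < ℓ) (hℓu : ℓ < u)
    (hp : 1 < p) (hq : q ∈ Set.Icc (0:ℝ) (p - 1)) :
    volume (barSpq ℓ u p q)
    = ENNReal.ofReal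
        (((p ^ 2 - p * q + 3 * p - q - 1) * u ^ (p + 1) + 3 * ℓ ^ (p + 1)
            - (p + 1) * (p - q + 2) * ℓ * u ^ p)
          / (3 * (p + 1) * (p - q + 2))) := by
  obtain ⟨-, hq⟩ := hq
  have hu : 0 < u := hℓ.trans hℓu
  have hp1 : 0 < p + 1 := by linarith
  have hpq : 0 < p - q + 2 := by linarith
  have hassoc := volume_preserving_prodAssoc (α₁ := ℝ) (β₁ := ℝ) (γ₁ := ℝ)
  have hm := hassoc.measurable (measurableSet_barSpq ℓ u p q)
  have hint₁ : IntervalIntegrable (fun z : ℝ => u ^ p * (u - ℓ) * z ^ 2) volume 0 1 :=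
    Continuous.intervalIntegrable (by fun_prop) _ _
  have hint₂ : IntervalIntegrable
      (fun z : ℝ => (u ^ (p + 1) - ℓ ^ (p + 1)) / (p + 1) * z ^ (p - q + 1)) volume 0 1 :=
    (intervalIntegral.intervalIntegrable_rpow' (by linarith)).const_mul _
  rw [← hassoc.measure_preimage (measurableSet_barSpq ℓ u p q).nullMeasurableSet,
    Measure.volume_eq_prod, Measure.prod_apply_symm hm,
    lintegral_eq_ofReal_intervalIntegral zero_le_one (hint₁.sub hint₂)]
  · congr 1
    rw [intervalIntegral.integral_sub hint₁ hint₂, intervalIntegral.integral_const_mul,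
      intervalIntegral.integral_const_mul, integral_pow, integral_rpow (Or.inl (by linarith)),
      show p - q + 1 + 1 = p - q + 2 by ring, Real.one_rpow, Real.zero_rpow hpq.ne',
      Real.rpow_add_one hu.ne']
    field_simp
    ring
  · rintro z ⟨hz0, hz1⟩
    have hpow : z ^ (p - q + 1) ≤ z ^ 2 := by
      rw [← Real.rpow_two]
      exact Real.rpow_le_rpow_of_exponent_ge hz0 hz1 (by linarith)
    have hcoef : (u ^ (p + 1) - ℓ ^ (p + 1)) / (p + 1) ≤ u ^ p * (u - ℓ) := by
      rw [← integral_rpow (Or.inl (by linarith))]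
      calc ∫ x in ℓ..u, x ^ p ≤ ∫ _ in ℓ..u, u ^ p :=
            intervalIntegral.integral_mono_on hℓu.le
              (intervalIntegral.intervalIntegrable_rpow' (by linarith)) intervalIntegrable_const
              fun x hx => Real.rpow_le_rpow (hℓ.le.trans hx.1) hx.2 (by linarith)
        _ = u ^ p * (u - ℓ) := by simp [mul_comm]
    have hnonneg : 0 ≤ u ^ p * (u - ℓ) :=
      mul_nonneg (Real.rpow_nonneg hu.le p) (sub_nonneg.2 hℓu.le)
    exact sub_nonneg.2 (mul_le_mul hcoef hpow (Real.rpow_nonneg hz0.le _) hnonneg)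
  · exact fun z hz => volume_barSpq_slice hℓ hℓu hp hq hz
  · intro z hz
    convert measure_empty (μ := (volume : Measure (ℝ × ℝ)))
    ext w
    simp only [Set.mem_preimage, Set.mem_empty_iff_false, iff_false]
    exact fun h => hz ⟨h.2.2.2.2.2.1, h.2.2.2.2.2.2⟩
end

section
/- Let 0 < ℓ < u, p > 1 and q ∈ [0, p−1]. Then the 3-dimensional Lebesgue volume of invbreve S_p^q(ℓ,u) := {(x,y,z) ∈ ℝ³ : y ≥ 0, x^p ≤ y·z^q, y ≤ (ℓ^p − ((u^p−ℓ^p)/(u−ℓ))·ℓ)·z + ((u^p−ℓ^p)/(u−ℓ))·x, ℓ·z ≤ x ≤ u·z, 0 ≤ z ≤ 1} equals ((p² − p·q + 3p − q − 1)·u^{p+1} + 3·ℓ^{p+1} − (p+1)·(p−q+2)·ℓ·u^p) / (3·(p+1)·(p−q+2)) − (u^p − ℓ^p)·(u−ℓ)/6. -/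
open MeasureTheory

/-- `invbreve S_p^q(ℓ,u)`; real powers (`Real.rpow`, with `0^0 = 1`). -/
noncomputable def invSpq (ℓ u p q : ℝ) : Set (ℝ × ℝ × ℝ) :=
  {s | 0 ≤ s.2.1 ∧ s.1 ^ p ≤ s.2.1 * s.2.2 ^ q ∧
       s.2.1 ≤ (ℓ ^ p - (u ^ p - ℓ ^ p) / (u - ℓ) * ℓ) * s.2.2
                 + (u ^ p - ℓ ^ p) / (u - ℓ) * s.1 ∧
       ℓ * s.2.2 ≤ s.1 ∧ s.1 ≤ u * s.2.2 ∧ 0 ≤ s.2.2 ∧ s.2.2 ≤ 1}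

theorem rpow_le_chord {ℓ u p t : ℝ} (hℓ : 0 ≤ ℓ) (hℓu : ℓ < u) (hp : 1 ≤ p)
    (ht : t ∈ Set.Icc ℓ u) :
    t ^ p ≤ (ℓ ^ p - (u ^ p - ℓ ^ p) / (u - ℓ) * ℓ) + (u ^ p - ℓ ^ p) / (u - ℓ) * t := by
  obtain ⟨h1, h2⟩ := ht
  have hd : 0 < u - ℓ := sub_pos.2 hℓu
  have hsum : (u - t) / (u - ℓ) + (t - ℓ) / (u - ℓ) = 1 := by
    field_simp
    ring
  have key := (convexOn_rpow hp).2 (Set.mem_Ici.2 hℓ) (Set.mem_Ici.2 (hℓ.trans hℓu.le))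
    (div_nonneg (sub_nonneg.2 h2) hd.le) (div_nonneg (sub_nonneg.2 h1) hd.le) hsum
  simp only [smul_eq_mul] at key
  have e : (u - t) / (u - ℓ) * ℓ + (t - ℓ) / (u - ℓ) * u = t := by
    field_simp; ring
  rw [e] at key
  refine key.trans (le_of_eq ?_)
  field_simp
  ring

theorem rpow_div_rpow_le_homogenized_chord {ℓ u p q x z : ℝ} (hℓ : 0 ≤ ℓ) (hℓu : ℓ < u)
    (hp : 1 ≤ p) (hq : q ≤ p - 1) (hz : 0 < z) (hz1 : z ≤ 1)
    (hx : x ∈ Set.Icc (ℓ * z) (u * z)) :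
    x ^ p / z ^ q ≤ (ℓ ^ p - (u ^ p - ℓ ^ p) / (u - ℓ) * ℓ) * z
      + (u ^ p - ℓ ^ p) / (u - ℓ) * x := by
  obtain ⟨t, rfl⟩ : ∃ t, x = t * z := ⟨x / z, by field_simp⟩
  have h1 : ℓ ≤ t := le_of_mul_le_mul_right hx.1 hz
  have h2 : t ≤ u := le_of_mul_le_mul_right hx.2 hz
  have ht : 0 ≤ t := hℓ.trans h1
  have hc := rpow_le_chord hℓ hℓu hp ⟨h1, h2⟩
  have hzle : z ^ (p - q) ≤ z := by
    simpa using Real.rpow_le_rpow_of_exponent_ge hz hz1 (show 1 ≤ p - q by linarith)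
  calc (t * z) ^ p / z ^ q = t ^ p * z ^ (p - q) := by
        rw [Real.mul_rpow ht hz.le, Real.rpow_sub hz, mul_div_assoc]
    _ ≤ t ^ p * z := by gcongr
    _ ≤ ((ℓ ^ p - (u ^ p - ℓ ^ p) / (u - ℓ) * ℓ) + (u ^ p - ℓ ^ p) / (u - ℓ) * t) * z := by
        gcongr
    _ = _ := by ring

theorem measurableSet_invSpq (ℓ u p q : ℝ) : MeasurableSet (invSpq ℓ u p q) := by
  unfold invSpq
  measurability

theorem volume_eq_lintegral_lintegral_fibers {s : Set (ℝ × ℝ × ℝ)} (hs : MeasurableSet s) :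
    volume s = ∫⁻ z : ℝ, ∫⁻ x : ℝ, volume {y : ℝ | (x, y, z) ∈ s} := by
  have hmp : MeasurePreserving (fun w : ℝ × ℝ × ℝ => (w.2.1, w.2.2, w.1)) volume volume :=
    (volume_preserving_prodAssoc (α₁ := ℝ) (β₁ := ℝ) (γ₁ := ℝ)).comp
      (Measure.measurePreserving_swap (μ := (volume : Measure ℝ))
        (ν := (volume : Measure (ℝ × ℝ))))
  have hs' := hmp.measurable hs
  rw [← hmp.measure_preimage hs.nullMeasurableSet, Measure.volume_eq_prod,
    Measure.prod_apply hs']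
  refine lintegral_congr fun z => ?_
  rw [Measure.volume_eq_prod, Measure.prod_apply (measurable_prodMk_left hs')]
  rfl

theorem integral_chord_sub_rpow_div {ℓ u p q z A m : ℝ} (hℓ : 0 < ℓ) (hℓu : ℓ < u)
    (hp : 1 < p) (hz : 0 < z) :
    ∫ x in (ℓ * z)..(u * z), (A * z + m * x - x ^ p / z ^ q)
      = (A * (u - ℓ) + m * (u ^ 2 - ℓ ^ 2) / 2) * z ^ (2 : ℕ)
        - (u ^ (p + 1) - ℓ ^ (p + 1)) / (p + 1) * z ^ (p - q + 1) := by
  have hint : IntervalIntegrable (fun x : ℝ => x ^ p) volume (ℓ * z) (u * z) :=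
    intervalIntegral.intervalIntegrable_rpow' (by linarith)
  rw [intervalIntegral.integral_sub (Continuous.intervalIntegrable (by fun_prop) _ _)
      (hint.div_const _),
    intervalIntegral.integral_add (Continuous.intervalIntegrable (by fun_prop) _ _)
      (Continuous.intervalIntegrable (by fun_prop) _ _),
    intervalIntegral.integral_const, intervalIntegral.integral_const_mul, integral_id,
    intervalIntegral.integral_div, integral_rpow (Or.inl (by linarith)),
    Real.mul_rpow (hℓ.trans hℓu).le hz.le, Real.mul_rpow hℓ.le hz.le,
    show p - q + 1 = p + 1 - q by ring, Real.rpow_sub hz]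
  simp only [smul_eq_mul]
  ring

theorem integral_sq_sub_rpow {a b r : ℝ} (hr : -1 < r) :
    ∫ z in (0 : ℝ)..1, (a * z ^ (2 : ℕ) - b * z ^ r) = a / 3 - b / (r + 1) := by
  have hint : IntervalIntegrable (fun x : ℝ => x ^ r) volume 0 1 :=
    intervalIntegral.intervalIntegrable_rpow' hr
  rw [intervalIntegral.integral_sub (Continuous.intervalIntegrable (by fun_prop) _ _)
      (hint.const_mul _), intervalIntegral.integral_const_mul,
    intervalIntegral.integral_const_mul, integral_pow, integral_rpow (Or.inl hr),
    Real.one_rpow, Real.zero_rpow (by linarith)]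
  norm_num
  ring

theorem setLIntegral_Ioc_ofReal_eq_ofReal_intervalIntegral {f : ℝ → ℝ} {a b : ℝ} (hab : a ≤ b)
    (hf : IntervalIntegrable f volume a b) (h0 : ∀ x ∈ Set.Ioc a b, 0 ≤ f x) :
    ∫⁻ x in Set.Ioc a b, ENNReal.ofReal (f x) = ENNReal.ofReal (∫ x in a..b, f x) := by
  rw [intervalIntegral.integral_of_le hab,
    ofReal_integral_eq_lintegral_ofReal ((intervalIntegrable_iff_integrableOn_Ioc_of_le hab).1 hf)]
  filter_upwards [ae_restrict_mem measurableSet_Ioc] with x hx using h0 x hx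

theorem invSpq_fiber {ℓ u p q x z : ℝ} (hℓ : 0 < ℓ) (hz : z ∈ Set.Ioc (0 : ℝ) 1)
    (hx : x ∈ Set.Icc (ℓ * z) (u * z)) :
    {y : ℝ | (x, y, z) ∈ invSpq ℓ u p q} = Set.Icc (x ^ p / z ^ q)
      ((ℓ ^ p - (u ^ p - ℓ ^ p) / (u - ℓ) * ℓ) * z + (u ^ p - ℓ ^ p) / (u - ℓ) * x) := by
  have hzq : 0 < z ^ q := Real.rpow_pos_of_pos hz.1 q
  have hx0 : 0 ≤ x := (mul_pos hℓ hz.1).le.trans hx.1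
  ext y
  simp only [invSpq, Set.mem_ofPred_eq, Set.mem_Icc, div_le_iff₀ hzq]
  refine ⟨fun h => ⟨h.2.1, h.2.2.1⟩, fun h => ⟨?_, h.1, h.2, hx.1, hx.2, hz.1.le, hz.2⟩⟩
  exact nonneg_of_mul_nonneg_left ((Real.rpow_nonneg hx0 p).trans h.1) hzq

theorem lintegral_invSpq_fiber {ℓ u p q z : ℝ} (hℓ : 0 < ℓ) (hℓu : ℓ < u)
    (hp : 1 < p) (hq : q ≤ p - 1) (hz : z ∈ Set.Ioc (0 : ℝ) 1) :
    0 ≤ ∫ x in (ℓ * z)..(u * z), ((ℓ ^ p - (u ^ p - ℓ ^ p) / (u - ℓ) * ℓ) * z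
        + (u ^ p - ℓ ^ p) / (u - ℓ) * x - x ^ p / z ^ q) ∧
    ∫⁻ x : ℝ, volume {y : ℝ | (x, y, z) ∈ invSpq ℓ u p q}
      = ENNReal.ofReal (∫ x in (ℓ * z)..(u * z), ((ℓ ^ p - (u ^ p - ℓ ^ p) / (u - ℓ) * ℓ) * z
        + (u ^ p - ℓ ^ p) / (u - ℓ) * x - x ^ p / z ^ q)) := by
  have hab : ℓ * z ≤ u * z := mul_le_mul_of_nonneg_right hℓu.le hz.1.le
  have h0 : ∀ x ∈ Set.Icc (ℓ * z) (u * z), 0 ≤ (ℓ ^ p - (u ^ p - ℓ ^ p) / (u - ℓ) * ℓ) * z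
        + (u ^ p - ℓ ^ p) / (u - ℓ) * x - x ^ p / z ^ q := fun x hx =>
    sub_nonneg.2 (rpow_div_rpow_le_homogenized_chord hℓ.le hℓu hp.le hq hz.1 hz.2 hx)
  refine ⟨intervalIntegral.integral_nonneg hab h0, ?_⟩
  have hint : IntervalIntegrable (fun x : ℝ => x ^ p) volume (ℓ * z) (u * z) :=
    intervalIntegral.intervalIntegrable_rpow' (by linarith)
  rw [← setLIntegral_Ioc_ofReal_eq_ofReal_intervalIntegral hab
    ((Continuous.intervalIntegrable (by fun_prop) _ _).sub (hint.div_const _))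
    fun x hx => h0 x (Set.Ioc_subset_Icc_self hx)]
  have hsupp : ∀ x ∉ Set.Icc (ℓ * z) (u * z),
      volume {y : ℝ | (x, y, z) ∈ invSpq ℓ u p q} = 0 := by
    intro x hx
    convert measure_empty (μ := (volume : Measure ℝ))
    ext y
    simp only [invSpq, Set.mem_ofPred_eq, Set.mem_empty_iff_false, iff_false]
    exact fun h => hx ⟨h.2.2.2.1, h.2.2.2.2.1⟩
  rw [← setLIntegral_eq_of_support_subset
      (s := Set.Icc (ℓ * z) (u * z)) (Function.support_subset_iff'.2 hsupp),
    setLIntegral_congr Ioc_ae_eq_Icc]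
  refine setLIntegral_congr_fun measurableSet_Icc fun x hx => ?_
  simp only [invSpq_fiber hℓ hz hx, Real.volume_Icc]

theorem invSpq_volume (ℓ u p q : ℝ) (hℓ : 0 < ℓ) (hℓu : ℓ < u)
    (hp : 1 < p) (hq : q ∈ Set.Icc (0:ℝ) (p - 1)) :
    volume (invSpq ℓ u p q)
    = ENNReal.ofReal
        (((p ^ 2 - p * q + 3 * p - q - 1) * u ^ (p + 1) + 3 * ℓ ^ (p + 1)
            - (p + 1) * (p - q + 2) * ℓ * u ^ p)
          / (3 * (p + 1) * (p - q + 2))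
          - (u ^ p - ℓ ^ p) * (u - ℓ) / 6) := by
  have hsupp : ∀ z ∉ Set.Icc (0 : ℝ) 1,
      ∫⁻ x : ℝ, volume {y : ℝ | (x, y, z) ∈ invSpq ℓ u p q} = 0 := by
    intro z hz
    have hempty : ∀ x : ℝ, {y : ℝ | (x, y, z) ∈ invSpq ℓ u p q} = ∅ := fun x =>
      Set.eq_empty_of_forall_notMem fun y h => hz h.2.2.2.2.2
    simp [hempty]
  rw [volume_eq_lintegral_lintegral_fibers (measurableSet_invSpq ℓ u p q),
    ← setLIntegral_eq_of_support_subset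
      (s := Set.Icc (0 : ℝ) 1) (Function.support_subset_iff'.2 hsupp),
    ← setLIntegral_congr Ioc_ae_eq_Icc]
  have hslice := fun z hz => lintegral_invSpq_fiber (z := z) hℓ hℓu hp hq.2 hz
  rw [setLIntegral_congr_fun measurableSet_Ioc fun z hz => by
    rw [(hslice z hz).2, integral_chord_sub_rpow_div hℓ hℓu hp hz.1]]
  have hr : -1 < p - q + 1 := by linarith [hq.2]
  have hint : IntervalIntegrable (fun z : ℝ => z ^ (p - q + 1)) volume 0 1 :=
    intervalIntegral.intervalIntegrable_rpow' hr
  rw [setLIntegral_Ioc_ofReal_eq_ofReal_intervalIntegral zero_le_one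
    ((Continuous.intervalIntegrable (by fun_prop) _ _).sub (hint.const_mul _))
    fun z hz => by
      rw [← integral_chord_sub_rpow_div hℓ hℓu hp hz.1]
      exact (hslice z hz).1,
    integral_sq_sub_rpow hr]
  congr 1
  have hd : u - ℓ ≠ 0 := (sub_pos.2 hℓu).ne'
  have hp1 : p + 1 ≠ 0 := by linarith
  have hpq : p - q + 2 ≠ 0 := by linarith [hq.2]
  rw [show p - q + 1 + 1 = p - q + 2 by ring, Real.rpow_add_one (hℓ.trans hℓu).ne',
    Real.rpow_add_one hℓ.ne']
  field_simp
  ring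
end
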